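/- There is a constant c > 0 such that for every integer N there exist an integer n ≥ N and a finite simple graph G with the following three properties: (1) G is 2-degenerate; (2) G contains a path on n vertices; (3) every induced path in G has at most c · log₂ log₂ n · log₂ log₂ log₂ n vertices. -/

import Mathlib

/-- A graph is `k`-degenerate if every nonempty (finite) set of vertices contains a vertex
with at most `k` neighbors inside the set. -/
def Degenerate {V : Type*} (k : ℕ) (G : SimpleGraph V) : Prop :=
  ∀ S : Set V, S.Finite → S.Nonempty → ∃ v ∈ S, {u ∈ S | G.Adj v u}.ncard ≤ k

/-- `G` contains a (not necessarily induced) path on `n` vertices. -/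
def HasPathOn {V : Type*} (G : SimpleGraph V) (n : ℕ) : Prop :=
  ∃ p : Fin n → V, Function.Injective p ∧
    ∀ (i : ℕ) (h : i + 1 < n), G.Adj (p ⟨i, Nat.lt_of_succ_lt h⟩) (p ⟨i + 1, h⟩)

/-- `G` contains an induced path on `n` vertices. -/
def HasInducedPathOn {V : Type*} (G : SimpleGraph V) (n : ℕ) : Prop :=
  ∃ p : Fin n → V, Function.Injective p ∧
    ∀ i j : Fin n, G.Adj (p i) (p j) ↔ (i.val + 1 = j.val ∨ j.val + 1 = i.val)

/-- `l` lists the vertices of an induced path of `G` in order. -/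
def InducedList {V : Type} (G : SimpleGraph V) (l : List V) : Prop :=
  l.Nodup ∧ l.IsChain G.Adj ∧
    ∀ l₁ a l₂ b l₃, l = l₁ ++ a :: (l₂ ++ b :: l₃) → G.Adj a b → l₂ = []

namespace InducedList

variable {V W : Type} {G : SimpleGraph V}

theorem left {l m : List V} (h : InducedList G (l ++ m)) : InducedList G l := by
  refine ⟨(List.nodup_append.1 h.1).1, (List.isChain_append.1 h.2.1).1, ?_⟩
  rintro l₁ a l₂ b l₃ rfl
  exact h.2.2 l₁ a l₂ b (l₃ ++ m) (by simp)

theorem right {l m : List V} (h : InducedList G (l ++ m)) : InducedList G m := by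
  refine ⟨(List.nodup_append.1 h.1).2.1, (List.isChain_append.1 h.2.1).2.1, ?_⟩
  rintro l₁ a l₂ b l₃ rfl
  exact h.2.2 (l ++ l₁) a l₂ b l₃ (by simp)

theorem reverse {l : List V} (h : InducedList G l) : InducedList G l.reverse := by
  refine ⟨List.nodup_reverse.2 h.1, ?_, ?_⟩
  · rw [List.isChain_reverse]
    exact h.2.1.imp fun _ _ hab => hab.symm
  · intro l₁ a l₂ b l₃ e hab
    have e' := congrArg List.reverse e
    have := h.2.2 l₃.reverse b l₂.reverse a l₁.reverse (by simpa using e') hab.symm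
    simpa using this

theorem of_map {G' : SimpleGraph W} {f : V → W} (hf : ∀ x y, G'.Adj (f x) (f y) ↔ G.Adj x y)
    {l : List V} (h : InducedList G' (l.map f)) : InducedList G l := by
  refine ⟨List.Nodup.of_map f h.1, ?_, ?_⟩
  · have := h.2.1
    rw [List.isChain_map] at this
    exact this.imp fun x y hxy => (hf x y).1 hxy
  · rintro l₁ a l₂ b l₃ rfl hab
    have := h.2.2 (l₁.map f) (f a) (l₂.map f) (f b) (l₃.map f) (by simp) ((hf a b).2 hab)
    simpa using this

end InducedList

/-- A graph with slots (pairs of adjacent vertices below which further graphs are hung) whose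
vertices may be adjacent to vertices of an external context: `sees x i b` says that `x` is adjacent
to the `b`-th vertex of the `i`-th pair of the context. -/
structure Gadget (V E : Type) where
  G : SimpleGraph V
  slot : E → Bool → V
  sees : V → ℕ → Bool → Prop
  slot_adj : ∀ e, G.Adj (slot e false) (slot e true)

namespace Gadget

variable {V E W I : Type}

/-- Adjacency in the composition of two gadgets. -/
def compAdj (F : Gadget V E) (H : Gadget W I) : V ⊕ E × W → V ⊕ E × W → Prop
  | .inl x, .inl y => F.G.Adj x y
  | .inl x, .inr (e, y) => ∃ b, x = F.slot e b ∧ H.sees y 0 b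
  | .inr (e, y), .inl x => ∃ b, x = F.slot e b ∧ H.sees y 0 b
  | .inr (e, y), .inr (e', y') => e = e' ∧ H.G.Adj y y'

/-- Hang a copy of `H` below every slot of `F`; the first pair of the context of each copy is
the slot it hangs below. -/
def comp (F : Gadget V E) (H : Gadget W I) : Gadget (V ⊕ E × W) (E × I) where
  G :=
    { Adj := compAdj F H
      symm := ⟨by
        rintro (x | ⟨e, y⟩) (x' | ⟨e', y'⟩) h
        · exact h.symm
        · exact h
        · exact h
        · exact ⟨h.1.symm, h.2.symm⟩⟩
      loopless := ⟨by
        rintro (x | ⟨e, y⟩) h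
        · exact F.G.irrefl h
        · exact H.G.irrefl h.2⟩ }
  slot e b := .inr (e.1, H.slot e.2 b)
  sees x i b := match x with
    | .inl x => F.sees x i b
    | .inr (_, y) => H.sees y (i + 1) b
  slot_adj e := ⟨rfl, H.slot_adj e.2⟩

/-- Identify the first two pairs of the context. -/
def merge (B : Gadget V E) : Gadget V E where
  G := B.G
  slot := B.slot
  sees x i b := B.sees x (i + 1) b ∨ (i = 0 ∧ B.sees x 0 b)
  slot_adj := B.slot_adj

/-- The list begins at a vertex of a slot. -/
def StartsAtSlot (X : Gadget V E) (Q : List V) : Prop := ∃ e b l, Q = X.slot e b :: l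

/-- No vertex of the list sees the given vertex of the context. -/
def Avoids (X : Gadget V E) (d : ℕ) (c : Bool) (Q : List V) : Prop := ∀ x ∈ Q, ¬ X.sees x d c

/-- The first vertex of the list, and no other one, sees the given vertex of the context. -/
def SeesFirst (X : Gadget V E) (d : ℕ) (c : Bool) (Q : List V) : Prop :=
  ∃ x l, Q = x :: l ∧ X.sees x d c ∧ X.Avoids d c l

variable {X F B : Gadget V E} {H : Gadget W I}

theorem SeesFirst.ne_nil {d c Q} (h : X.SeesFirst d c Q) : Q ≠ [] := by
  obtain ⟨x, l, rfl, -⟩ := h; simp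

theorem Avoids.left {d c P R} (h : X.Avoids d c (P ++ R)) : X.Avoids d c P :=
  fun x hx => h x (List.mem_append_left _ hx)

theorem Avoids.right {d c P R} (h : X.Avoids d c (P ++ R)) : X.Avoids d c R :=
  fun x hx => h x (List.mem_append_right _ hx)

theorem Avoids.reverse {d c P} (h : X.Avoids d c P) : X.Avoids d c P.reverse :=
  fun x hx => h x (List.mem_reverse.1 hx)

theorem SeesFirst.append {d c P R} (hP : P ≠ []) (h : X.SeesFirst d c (P ++ R)) :
    X.SeesFirst d c P ∧ X.Avoids d c R := by
  obtain ⟨x, l, e, hx, hl⟩ := h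
  obtain ⟨p, P, rfl⟩ := List.exists_cons_of_ne_nil hP
  simp only [List.cons_append, List.cons.injEq] at e
  obtain ⟨rfl, rfl⟩ := e
  exact ⟨⟨p, P, rfl, hx, hl.left⟩, hl.right⟩

theorem StartsAtSlot.append {P R} (hP : P ≠ []) (h : X.StartsAtSlot (P ++ R)) :
    X.StartsAtSlot P := by
  obtain ⟨e, b, l, h⟩ := h
  obtain ⟨p, P, rfl⟩ := List.exists_cons_of_ne_nil hP
  simp only [List.cons_append, List.cons.injEq] at h
  obtain ⟨rfl, rfl⟩ := h
  exact ⟨e, b, P, rfl⟩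

/-- The copy of `H` below the slot `e`, inside the composition. -/
abbrev below (_ : Gadget V E) (_ : Gadget W I) (e : E) : W → (V ⊕ E × W) := fun y => Sum.inr (e, y)

/-- The copy of `F` inside the composition. -/
abbrev above (_ : Gadget V E) (_ : Gadget W I) : V → (V ⊕ E × W) := Sum.inl

theorem avoids_above {d c} {M : List V} :
    (F.comp H).Avoids d c (M.map (above F H)) ↔ F.Avoids d c M := by
  simp [Avoids, comp]

theorem avoids_below {d c e} {A : List W} :
    (F.comp H).Avoids d c (A.map (below F H e)) ↔ H.Avoids (d + 1) c A := by
  simp [Avoids, comp]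

theorem seesFirst_above {d c} {M : List V} :
    (F.comp H).SeesFirst d c (M.map (above F H)) ↔ F.SeesFirst d c M := by
  cases M with
  | nil => simp [SeesFirst]
  | cons x M =>
    have := avoids_above (F := F) (H := H) (d := d) (c := c) (M := M)
    simp only [SeesFirst, List.map_cons, List.cons.injEq]
    constructor
    · rintro ⟨_, _, ⟨rfl, rfl⟩, h, h'⟩; exact ⟨_, _, ⟨rfl, rfl⟩, h, this.1 h'⟩
    · rintro ⟨_, _, ⟨rfl, rfl⟩, h, h'⟩; exact ⟨_, _, ⟨rfl, rfl⟩, h, this.2 h'⟩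

theorem seesFirst_below {d c e} {A : List W} :
    (F.comp H).SeesFirst d c (A.map (below F H e)) ↔ H.SeesFirst (d + 1) c A := by
  cases A with
  | nil => simp [SeesFirst]
  | cons x A =>
    have := avoids_below (F := F) (H := H) (e := e) (d := d) (c := c) (A := A)
    simp only [SeesFirst, List.map_cons, List.cons.injEq]
    constructor
    · rintro ⟨_, _, ⟨rfl, rfl⟩, h, h'⟩; exact ⟨_, _, ⟨rfl, rfl⟩, h, this.1 h'⟩
    · rintro ⟨_, _, ⟨rfl, rfl⟩, h, h'⟩; exact ⟨_, _, ⟨rfl, rfl⟩, h, this.2 h'⟩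

theorem startsAtSlot_below {e} {A : List W} :
    (F.comp H).StartsAtSlot (A.map (below F H e)) ↔ H.StartsAtSlot A := by
  cases A with
  | nil => simp [StartsAtSlot]
  | cons x A =>
    constructor
    · rintro ⟨e', b, l, h⟩
      simp only [List.map_cons, List.cons.injEq, comp, below, Sum.inr.injEq, Prod.mk.injEq] at h
      exact ⟨e'.2, b, A, by rw [h.1.2]⟩
    · rintro ⟨e', b, l, h⟩
      simp only [List.cons.injEq] at h
      exact ⟨(e, e'), b, A.map (below F H e), by simp [h.1, comp]⟩

theorem not_startsAtSlot_above {M : List V} :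
    ¬ (F.comp H).StartsAtSlot (M.map (above F H)) := by
  rintro ⟨e, b, l, h⟩
  cases M with
  | nil => simp at h
  | cons x M => simp [comp] at h

/-- The possible shapes of an induced path in a composition. -/
inductive Split (F : Gadget V E) (H : Gadget W I) : List (V ⊕ E × W) → Prop
  | above (M) : InducedList F.G M → Split F H (M.map (above F H))
  | below (e A) : A ≠ [] → InducedList H.G A → Split F H (A.map (below F H e))
  | down (M e b Z) : M ≠ [] → InducedList F.G M → InducedList H.G Z →
      F.StartsAtSlot M.reverse → H.SeesFirst 0 b Z →
      Split F H (M.map (F.above H) ++ Z.map (F.below H e))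
  | up (e b A M) : M ≠ [] → InducedList H.G A → InducedList F.G M →
      F.StartsAtSlot M → H.SeesFirst 0 b A.reverse →
      Split F H (A.map (F.below H e) ++ M.map (F.above H))
  | turn (e b A M e' b' Z) : M ≠ [] → InducedList H.G A → InducedList F.G M → InducedList H.G Z →
      F.StartsAtSlot M → F.StartsAtSlot M.reverse →
      H.SeesFirst 0 b A.reverse → H.SeesFirst 0 b' Z →
      Split F H (A.map (F.below H e) ++ (M.map (F.above H) ++ Z.map (F.below H e')))

theorem exists_below {R : List (V ⊕ E × W)} {e y} (h : ∀ z ∈ Sum.inr (e, y) :: R, z.isRight)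
    (hR : (Sum.inr (e, y) :: R).IsChain (F.comp H).G.Adj) :
    ∃ A : List W, R = A.map (below F H e) := by
  induction R generalizing y with
  | nil => exact ⟨[], rfl⟩
  | cons z R ih =>
    rw [List.isChain_cons_cons] at hR
    have hz := h z (by simp)
    obtain z | ⟨e', y'⟩ := z
    · simp at hz
    · obtain rfl : e = e' := hR.1.1
      obtain ⟨A, rfl⟩ := ih (y := y') (fun z hz => h z (List.mem_cons_of_mem _ hz)) hR.2
      exact ⟨y' :: A, rfl⟩

theorem exists_below' {R : List (V ⊕ E × W)} (hR : R.IsChain (F.comp H).G.Adj) (hne : R ≠ [])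
    (h : ∀ z ∈ R, z.isRight) : ∃ e, ∃ A : List W, A ≠ [] ∧ R = A.map (below F H e) := by
  obtain ⟨z, R, rfl⟩ := List.exists_cons_of_ne_nil hne
  have hz := h z (by simp)
  obtain z | ⟨e, y⟩ := z
  · simp at hz
  · obtain ⟨A, rfl⟩ := exists_below (F := F) (H := H) h hR
    exact ⟨e, y :: A, by simp, rfl⟩

theorem exists_above {R : List (V ⊕ E × W)} (h : ∀ z ∈ R, z.isLeft) :
    ∃ M : List V, R = M.map (above F H) := by
  induction R with
  | nil => exact ⟨[], rfl⟩
  | cons z R ih =>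
    obtain ⟨M, rfl⟩ := ih fun z hz => h z (List.mem_cons_of_mem _ hz)
    have hz := h z (by simp)
    obtain x | y := z
    · exact ⟨x :: M, rfl⟩
    · simp at hz

theorem inducedList_above {M : List V} (h : InducedList (F.comp H).G (M.map (above F H))) :
    InducedList F.G M := h.of_map (f := Sum.inl) fun _ _ => Iff.rfl

theorem inducedList_below {e} {A : List W}
    (h : InducedList (F.comp H).G (A.map (below F H e))) : InducedList H.G A :=
  h.of_map (G' := (F.comp H).G) (f := below F H e) fun _ _ => ⟨fun h => h.2, fun h => ⟨rfl, h⟩⟩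

/-- The junction of a part in `F` with a following part below a slot. -/
theorem junction {M : List V} {Z : List W} {e} (hM : M ≠ []) (hZ : Z ≠ [])
    (h : InducedList (F.comp H).G (M.map (above F H) ++ Z.map (below F H e))) :
    ∃ b M', M = M' ++ [F.slot e b] ∧ H.SeesFirst 0 b Z := by
  obtain ⟨z, Z, rfl⟩ := List.exists_cons_of_ne_nil hZ
  obtain ⟨M', x, rfl⟩ : ∃ M' x, M = M' ++ [x] :=
    ⟨M.dropLast, M.getLast hM, (List.dropLast_append_getLast hM).symm⟩
  have hadj : (F.comp H).G.Adj (Sum.inl x) (Sum.inr (e, z)) := by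
    have := (List.isChain_append.1 h.2.1).2.2
    simpa using this
  obtain ⟨b, rfl, hb⟩ := hadj
  refine ⟨b, M', rfl, z, Z, rfl, hb, fun y hy hs => ?_⟩
  obtain ⟨Z₁, Z₂, rfl⟩ := List.append_of_mem hy
  have := h.2.2 (M'.map (above F H)) (Sum.inl (F.slot e b))
    ((z :: Z₁).map (below F H e)) (Sum.inr (e, y)) (Z₂.map (below F H e)) (by simp) ⟨b, rfl, hs⟩
  simp at this

theorem split_of_isLeft {x : V} {Q : List (V ⊕ E × W)}
    (h : InducedList (F.comp H).G (Sum.inl x :: Q)) :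
    ∃ M : List V, M ≠ [] ∧ (Sum.inl x :: Q = M.map (above F H) ∨
      ∃ e, ∃ Z : List W, Z ≠ [] ∧ Sum.inl x :: Q = M.map (above F H) ++ Z.map (below F H e)) := by
  classical
  set P := (Sum.inl x :: Q) with hP
  obtain ⟨M, hM⟩ := exists_above (F := F) (H := H) (R := P.takeWhile Sum.isLeft)
    fun z hz => List.mem_takeWhile_imp hz
  have hsplit := List.takeWhile_append_dropWhile (p := Sum.isLeft) (l := P)
  have hMne : M ≠ [] := by
    rintro rfl
    simp [hP] at hM
  refine ⟨M, hMne, ?_⟩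
  rw [hM] at hsplit
  by_cases hR : P.dropWhile Sum.isLeft = []
  · left; rw [← hsplit, hR, List.append_nil]
  right
  set R := P.dropWhile Sum.isLeft with hRdef
  have hhead : ∀ z ∈ R.head?, z.isRight := by
    intro z hz
    have := List.head?_dropWhile_not Sum.isLeft P
    rw [← hRdef] at this
    rw [Option.mem_def] at hz
    rw [hz] at this
    simpa using this
  rw [← hsplit] at h ⊢
  have hRind := h.right
  have hall : ∀ z ∈ R, z.isRight := by
    by_contra hcon
    push Not at hcon
    -- the first vertex of `F` in `R`
    set R₁ := R.takeWhile Sum.isRight with hR₁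
    have hs2 := List.takeWhile_append_dropWhile (p := Sum.isRight) (l := R)
    have hd : R.dropWhile Sum.isRight ≠ [] := by
      intro hnil
      obtain ⟨z, hz, hz'⟩ := hcon
      rw [List.dropWhile_eq_nil_iff] at hnil
      exact hz' (hnil z hz)
    obtain ⟨w, R₂, hw⟩ := List.exists_cons_of_ne_nil hd
    have hwleft : w.isLeft := by
      have := List.head?_dropWhile_not Sum.isRight R
      rw [hw] at this
      simpa using this
    obtain z | z := w
    swap
    · simp at hwleft
    have hR₁ne : R₁ ≠ [] := by
      obtain ⟨r, R', hr⟩ := List.exists_cons_of_ne_nil hR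
      have := hhead r (by simp [hr])
      rw [hR₁, hr, List.takeWhile_cons, if_pos this]
      simp
    rw [hw, ← hR₁] at hs2
    rw [← hs2] at h hRind
    obtain ⟨e, A, hA, hA'⟩ := exists_below' (F := F) (H := H) hRind.left.2.1 hR₁ne
      fun z hz => List.mem_takeWhile_imp hz
    rw [hA'] at h hRind
    have h1 : InducedList (F.comp H).G (M.map (above F H) ++ A.map (below F H e)) := by
      rw [← List.append_assoc] at h
      exact h.left
    obtain ⟨b, M', rfl, -⟩ := junction hMne hA h1
    have h2 : InducedList (F.comp H).G ([z].map (above F H) ++ (A.reverse).map (below F H e)) := by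
      have : InducedList (F.comp H).G (A.map (below F H e) ++ [Sum.inl z]) := by
        have e1 : A.map (below F H e) ++ Sum.inl z :: R₂ =
          (A.map (below F H e) ++ [Sum.inl z]) ++ R₂ := by simp
        rw [e1] at hRind
        exact hRind.left
      simpa using this.reverse
    obtain ⟨b', M'', hz, -⟩ := junction (by simp) (by simpa using hA) h2
    obtain ⟨rfl, rfl⟩ : M'' = [] ∧ z = F.slot e b' := by
      cases M'' with
      | nil => simpa using hz
      | cons _ _ => simp at hz
    have hbb : b ≠ b' := by
      rintro rfl
      have := h.1
      rw [List.nodup_append] at this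
      exact this.2.2 (Sum.inl (F.slot e b)) (by simp) (Sum.inl (F.slot e b)) (by simp) rfl
    have hadj : F.G.Adj (F.slot e b) (F.slot e b') := by
      cases b <;> cases b' <;> simp at hbb
      · exact F.slot_adj e
      · exact (F.slot_adj e).symm
    have := h.2.2 (M'.map (above F H)) (Sum.inl (F.slot e b)) (A.map (below F H e))
      (Sum.inl (F.slot e b')) R₂ (by simp) hadj
    simp [hA] at this
  obtain ⟨e, Z, hZ, hZ'⟩ := exists_below' hRind.2.1 hR hall
  exact ⟨e, Z, hZ, by rw [hZ']⟩

theorem split {Q : List (V ⊕ E × W)} (h : InducedList (F.comp H).G Q) : Split F H Q := by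
  classical
  have key : ∀ M : List V, ∀ e, ∀ Z : List W, M ≠ [] → Z ≠ [] →
      InducedList (F.comp H).G (M.map (above F H) ++ Z.map (below F H e)) →
      F.StartsAtSlot M.reverse ∧ ∃ b, H.SeesFirst 0 b Z := by
    intro M e Z hM hZ h
    obtain ⟨b, M', rfl, hb⟩ := junction hM hZ h
    exact ⟨⟨e, b, M'.reverse, by simp⟩, b, hb⟩
  have key' : ∀ e, ∀ A : List W, ∀ M : List V, A ≠ [] → M ≠ [] →
      InducedList (F.comp H).G (A.map (below F H e) ++ M.map (above F H)) →
      F.StartsAtSlot M ∧ ∃ b, H.SeesFirst 0 b A.reverse := by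
    intro e A M hA hM h
    have := h.reverse
    rw [List.reverse_append, ← List.map_reverse, ← List.map_reverse] at this
    have := key M.reverse e A.reverse (by simpa) (by simpa) this
    rwa [List.reverse_reverse] at this
  have hs := List.takeWhile_append_dropWhile (p := Sum.isRight) (l := Q)
  set P := Q.takeWhile Sum.isRight with hP
  set R := Q.dropWhile Sum.isRight with hR
  have hPr : ∀ z ∈ P, z.isRight := fun z hz => List.mem_takeWhile_imp hz
  by_cases hRn : R = []
  · rw [hRn, List.append_nil] at hs
    by_cases hPn : P = []
    · rw [← hs, hPn]
      exact Split.above [] ⟨by simp, by simp, by simp⟩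
    · rw [← hs] at h
      obtain ⟨e, A, hA, hA'⟩ := exists_below' h.2.1 hPn hPr
      rw [← hs]
      rw [hA'] at h ⊢
      exact Split.below e A hA (inducedList_below h)
  · obtain ⟨w, R', hw⟩ := List.exists_cons_of_ne_nil hRn
    have hwl : w.isLeft := by
      have := List.head?_dropWhile_not Sum.isRight Q
      rw [← hR, hw] at this
      simpa using this
    obtain x | x := w
    swap
    · simp at hwl
    rw [hw] at hs
    rw [← hs] at h ⊢
    obtain ⟨M, hM, hMZ⟩ := split_of_isLeft h.right
    by_cases hPn : P = []
    · rw [hPn, List.nil_append] at h ⊢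
      obtain hMZ | ⟨e, Z, hZ, hMZ⟩ := hMZ
      · rw [hMZ] at h ⊢
        exact Split.above M (inducedList_above h)
      · rw [hMZ] at h ⊢
        obtain ⟨h1, b, h2⟩ := key M e Z hM hZ h
        exact Split.down M e b Z hM (inducedList_above h.left) (inducedList_below h.right) h1 h2
    · obtain ⟨e, A, hA, hA'⟩ := exists_below' h.left.2.1 hPn hPr
      rw [hA'] at h ⊢
      obtain hMZ | ⟨e', Z, hZ, hMZ⟩ := hMZ
      · rw [hMZ] at h ⊢
        obtain ⟨h1, b, h2⟩ := key' e A M hA hM h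
        exact Split.up e b A M hM (inducedList_below h.left) (inducedList_above h.right) h1 h2
      · rw [hMZ] at h ⊢
        obtain ⟨h1, b, h2⟩ := key M e' Z hM hZ h.right
        have h' := h
        rw [← List.append_assoc] at h'
        obtain ⟨h3, b', h4⟩ := key' e A M hA hM h'.left
        exact Split.turn e b' A M e' b Z hM (inducedList_below h.left)
          (inducedList_above h.right.left) (inducedList_below h.right.right) h3 h1 h4 h2

/-- A bound for the induced paths joining slots that avoid a vertex of the context. -/
def SlotSlotBound (X : Gadget V E) (d n : ℕ) : Prop :=
  ∀ c Q, InducedList X.G Q → X.StartsAtSlot Q → X.StartsAtSlot Q.reverse → X.Avoids d c Q →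
    Q.length ≤ n

/-- A bound for the induced paths starting at a slot that avoid a vertex of the context. -/
def SlotBound (X : Gadget V E) (d n : ℕ) : Prop :=
  ∀ c Q, InducedList X.G Q → X.StartsAtSlot Q → X.Avoids d c Q → Q.length ≤ n

/-- A bound for the induced paths entering from a vertex of the context. -/
def EntryBound (X : Gadget V E) (d n : ℕ) : Prop :=
  ∀ c Q, InducedList X.G Q → X.SeesFirst d c Q → Q.length ≤ n

/-- A bound for the induced paths entering from a vertex of the context and ending at a slot. -/
def EntrySlotBound (X : Gadget V E) (d n : ℕ) : Prop :=
  ∀ c Q, InducedList X.G Q → X.SeesFirst d c Q → X.StartsAtSlot Q.reverse → Q.length ≤ n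

/-- A bound for all induced paths. -/
def PathBound (X : Gadget V E) (n : ℕ) : Prop := ∀ Q, InducedList X.G Q → Q.length ≤ n

/-- The induced paths joining two vertices of the context are short and see every vertex of the
context between these two. -/
def Between (X : Gadget V E) : Prop :=
  ∀ d₁ d₂ c₁ c₂ Q, InducedList X.G Q → d₂ < d₁ → X.SeesFirst d₁ c₁ Q →
    X.SeesFirst d₂ c₂ Q.reverse →
    Q.length ≤ 2 * (d₁ - d₂) + 2 ∧ ∀ j c, d₂ < j → j < d₁ → ¬ X.Avoids j c Q

/-- The induced paths from a vertex of the context to a slot see every vertex of the context on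
the way, from the index `k` on. -/
def EntrySees (X : Gadget V E) (k : ℕ) : Prop :=
  ∀ d c Q, InducedList X.G Q → X.SeesFirst d c Q → X.StartsAtSlot Q.reverse →
    ∀ j c', k ≤ j → j < d → ¬ X.Avoids j c' Q

/-- No induced path from the own slot to a lower slot avoids a vertex of the outer context. -/
def Sealed (X : Gadget V E) (d : ℕ) : Prop :=
  ∀ b c Q, InducedList X.G Q → X.SeesFirst 0 b Q → X.StartsAtSlot Q.reverse →
    ¬ X.Avoids (d + 1) c Q

section comp

theorem ne_nil_map {A : List V} {f : V → W} (h : A ≠ []) : A.map f ≠ [] := by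
  simpa using h

theorem not_startsAtSlot_above_append {M : List V} {R} (hM : M ≠ []) :
    ¬ (F.comp H).StartsAtSlot (M.map (above F H) ++ R) := fun h =>
  not_startsAtSlot_above (h.append (ne_nil_map hM))

theorem SeesFirst.ne_nil_of_reverse {d c} {Q : List V} (h : X.SeesFirst d c Q.reverse) :
    Q ≠ [] := by
  simpa using h.ne_nil

theorem startsAtSlot_below_append {e} {A : List W} {R} (hA : A ≠ [])
    (h : (F.comp H).StartsAtSlot (A.map (below F H e) ++ R)) : H.StartsAtSlot A :=
  startsAtSlot_below.1 (h.append (ne_nil_map hA))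

theorem seesFirst_below_append {e d c} {A : List W} {R} (hA : A ≠ [])
    (h : (F.comp H).SeesFirst d c (A.map (below F H e) ++ R)) :
    H.SeesFirst (d + 1) c A ∧ (F.comp H).Avoids d c R :=
  ⟨seesFirst_below.1 (h.append (ne_nil_map hA)).1, (h.append (ne_nil_map hA)).2⟩

theorem seesFirst_above_append {d c} {M : List V} {R} (hM : M ≠ [])
    (h : (F.comp H).SeesFirst d c (M.map (above F H) ++ R)) :
    F.SeesFirst d c M ∧ (F.comp H).Avoids d c R :=
  ⟨seesFirst_above.1 (h.append (ne_nil_map hM)).1, (h.append (ne_nil_map hM)).2⟩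

theorem SlotSlotBound.comp {d m a r n : ℕ} (hH : H.SlotSlotBound (d + 1) m)
    (hF : F.SlotSlotBound d a) (hr : H.EntrySlotBound 0 r) (hm : m ≤ n)
    (hn : H.Sealed d ∨ a + 2 * r ≤ n) : (F.comp H).SlotSlotBound d n := by
  intro c Q hQ h1 h2 h3
  cases split hQ with
  | above M hM => exact absurd h1 not_startsAtSlot_above
  | below e A hA hA' =>
    rw [← List.map_reverse] at h2
    have := hH c A hA' (startsAtSlot_below.1 h1) (startsAtSlot_below.1 h2) (avoids_below.1 h3)
    rw [List.length_map]; omega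
  | down M e b Z hM => exact absurd h1 (not_startsAtSlot_above_append hM)
  | up e b A M hM =>
    rw [List.reverse_append, ← List.map_reverse] at h2
    exact absurd h2 (not_startsAtSlot_above_append (by simpa))
  | turn e b A M e' b' Z hM hA hM' hZ s1 s2 s3 s4 =>
    rw [List.reverse_append, List.reverse_append, ← List.map_reverse, ← List.map_reverse,
      List.append_assoc] at h2
    have h2' := startsAtSlot_below_append (by simpa using s4.ne_nil) h2
    have h1' := startsAtSlot_below_append s3.ne_nil_of_reverse h1
    rcases hn with hn | hn
    · exact absurd (avoids_below.1 h3.right.right) (hn _ _ _ hZ s4 h2')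
    · have e1 := hr _ _ hA.reverse s3 (by rwa [List.reverse_reverse])
      have e2 := hr _ _ hZ s4 h2'
      have e3 := hF _ _ hM' s1 s2 (avoids_above.1 h3.right.left)
      simp only [List.length_append, List.length_map, List.length_reverse] at e1 ⊢
      omega

theorem SlotBound.comp {d m a r h x n : ℕ} (hH : H.SlotBound (d + 1) m)
    (hF : F.SlotSlotBound d a) (hF' : F.SlotBound d h) (hr : H.EntrySlotBound 0 r)
    (hx : H.EntryBound 0 x) (hm : m ≤ n)
    (hn : H.Sealed d ∨ r + h ≤ n ∧ r + a + x ≤ n) : (F.comp H).SlotBound d n := by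
  intro c Q hQ h1 h3
  cases split hQ with
  | above M hM => exact absurd h1 not_startsAtSlot_above
  | below e A hA hA' =>
    have := hH c A hA' (startsAtSlot_below.1 h1) (avoids_below.1 h3)
    rw [List.length_map]; omega
  | down M e b Z hM => exact absurd h1 (not_startsAtSlot_above_append hM)
  | up e b A M hM hA hM' s1 s2 =>
    have h1' := startsAtSlot_below_append s2.ne_nil_of_reverse h1
    rw [← List.reverse_reverse A] at h1'
    rcases hn with hn | hn
    · exact absurd (avoids_below.1 h3.left).reverse (hn _ _ _ hA.reverse s2 h1')
    · have e1 := hr _ _ hA.reverse s2 h1'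
      have e2 := hF' _ _ hM' s1 (avoids_above.1 h3.right)
      simp only [List.length_append, List.length_map, List.length_reverse] at e1 ⊢
      omega
  | turn e b A M e' b' Z hM hA hM' hZ s1 s2 s3 s4 =>
    have h1' := startsAtSlot_below_append s3.ne_nil_of_reverse h1
    rw [← List.reverse_reverse A] at h1'
    rcases hn with hn | hn
    · exact absurd (avoids_below.1 h3.left).reverse (hn _ _ _ hA.reverse s3 h1')
    · have e1 := hr _ _ hA.reverse s3 h1'
      have e2 := hx _ _ hZ s4
      have e3 := hF _ _ hM' s1 s2 (avoids_above.1 h3.right.left)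
      simp only [List.length_append, List.length_map, List.length_reverse] at e1 ⊢
      omega

theorem Between.length_le {d b c} {A : List W} (hH : H.Between) (hA : InducedList H.G A)
    (h0 : H.SeesFirst 0 b A.reverse) (h1 : H.SeesFirst (d + 1) c A) : A.length ≤ 2 * d + 4 := by
  have := (hH _ _ _ _ _ hA (Nat.succ_pos d) h1 h0).1
  omega

theorem EntryBound.comp {d m a r h x y n : ℕ} (hH : H.EntryBound (d + 1) m)
    (hF : F.SlotSlotBound d a) (hF' : F.SlotBound d h) (hr : F.EntrySlotBound d r)
    (hx : H.EntryBound 0 x) (hy : F.EntryBound d y) (hb : H.Between) (hm : m ≤ n) (hyn : y ≤ n)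
    (h1 : r + x ≤ n) (h2 : 2 * d + 4 + h ≤ n) (h3 : 2 * d + 4 + a + x ≤ n) :
    (F.comp H).EntryBound d n := by
  intro c Q hQ hs
  cases split hQ with
  | above M hM =>
    have := hy _ _ hM (seesFirst_above.1 hs)
    rw [List.length_map]; omega
  | below e A hA hA' =>
    have := hH _ _ hA' (seesFirst_below.1 hs)
    rw [List.length_map]; omega
  | down M e b Z hM hM' hZ s1 s2 =>
    have e1 := hr _ _ hM' (seesFirst_above_append hM hs).1 s1
    have e2 := hx _ _ hZ s2
    simp only [List.length_append, List.length_map]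
    omega
  | up e b A M hM hA hM' s1 s2 =>
    obtain ⟨t1, t2⟩ := seesFirst_below_append s2.ne_nil_of_reverse hs
    have e1 := hb.length_le hA s2 t1
    have e2 := hF' _ _ hM' s1 (avoids_above.1 t2)
    simp only [List.length_append, List.length_map]
    omega
  | turn e b A M e' b' Z hM hA hM' hZ s1 s2 s3 s4 =>
    obtain ⟨t1, t2⟩ := seesFirst_below_append s3.ne_nil_of_reverse hs
    have e1 := hb.length_le hA s3 t1
    have e2 := hF _ _ hM' s1 s2 (avoids_above.1 t2.left)
    have e3 := hx _ _ hZ s4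
    simp only [List.length_append, List.length_map]
    omega

theorem EntrySlotBound.comp {d m a r x n : ℕ} (hH : H.EntrySlotBound (d + 1) m)
    (hF : F.SlotSlotBound d a) (hr : F.EntrySlotBound d r)
    (hx : H.EntrySlotBound 0 x) (hb : H.Between) (hm : m ≤ n)
    (hn : H.Sealed d ∨ r + x ≤ n ∧ 2 * d + 4 + a + x ≤ n) :
    (F.comp H).EntrySlotBound d n := by
  intro c Q hQ hs h2
  cases split hQ with
  | above M hM =>
    rw [← List.map_reverse] at h2
    exact absurd h2 not_startsAtSlot_above
  | below e A hA hA' =>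
    rw [← List.map_reverse] at h2
    have := hH _ _ hA' (seesFirst_below.1 hs) (startsAtSlot_below.1 h2)
    rw [List.length_map]; omega
  | down M e b Z hM hM' hZ s1 s2 =>
    obtain ⟨t1, t2⟩ := seesFirst_above_append hM hs
    rw [List.reverse_append, ← List.map_reverse] at h2
    have h2' := startsAtSlot_below_append (by simpa using s2.ne_nil) h2
    rcases hn with hn | hn
    · exact absurd (avoids_below.1 t2) (hn _ _ _ hZ s2 h2')
    · have e1 := hr _ _ hM' t1 s1
      have e2 := hx _ _ hZ s2 h2'
      simp only [List.length_append, List.length_map]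
      omega
  | up e b A M hM hA hM' s1 s2 =>
    rw [List.reverse_append, ← List.map_reverse] at h2
    exact absurd h2 (not_startsAtSlot_above_append (by simpa))
  | turn e b A M e' b' Z hM hA hM' hZ s1 s2 s3 s4 =>
    rw [List.reverse_append, List.reverse_append, ← List.map_reverse, ← List.map_reverse,
      List.append_assoc] at h2
    have h2' := startsAtSlot_below_append (by simpa using s4.ne_nil) h2
    obtain ⟨t1, t2⟩ := seesFirst_below_append s3.ne_nil_of_reverse hs
    rcases hn with hn | hn
    · exact absurd (avoids_below.1 t2.right) (hn _ _ _ hZ s4 h2')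
    · have e1 := hb.length_le hA s3 t1
      have e2 := hF _ _ hM' s1 s2 (avoids_above.1 t2.left)
      have e3 := hx _ _ hZ s4 h2'
      simp only [List.length_append, List.length_map]
      omega

theorem PathBound.comp {d m a h x y n : ℕ} (hd : ∀ v c, ¬ F.sees v d c) (hH : H.PathBound m)
    (hF : F.PathBound y) (hF' : F.SlotSlotBound d a) (hF'' : F.SlotBound d h)
    (hx : H.EntryBound 0 x) (hm : m ≤ n) (hy : y ≤ n) (h1 : h + x ≤ n) (h2 : a + 2 * x ≤ n) :
    (F.comp H).PathBound n := by
  intro Q hQ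
  cases split hQ with
  | above M hM =>
    have := hF _ hM
    rw [List.length_map]; omega
  | below e A hA hA' =>
    have := hH _ hA'
    rw [List.length_map]; omega
  | down M e b Z hM hM' hZ s1 s2 =>
    have e1 := hF'' true _ hM'.reverse s1 fun v _ => hd v true
    have e2 := hx _ _ hZ s2
    simp only [List.length_append, List.length_map, List.length_reverse] at e1 ⊢
    omega
  | up e b A M hM hA hM' s1 s2 =>
    have e1 := hF'' true _ hM' s1 fun v _ => hd v true
    have e2 := hx _ _ hA.reverse s2
    simp only [List.length_append, List.length_map, List.length_reverse] at e2 ⊢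
    omega
  | turn e b A M e' b' Z hM hA hM' hZ s1 s2 s3 s4 =>
    have e1 := hF' true _ hM' s1 s2 fun v _ => hd v true
    have e2 := hx _ _ hZ s4
    have e3 := hx _ _ hA.reverse s3
    simp only [List.length_append, List.length_map, List.length_reverse] at e3 ⊢
    omega

theorem EntrySees.comp (hF : F.EntrySees 0) (hH : H.EntrySees 1) (hb : H.Between) :
    (F.comp H).EntrySees 0 := by
  intro d c Q hQ hs h2 j c' _ hj hav
  cases split hQ with
  | above M hM =>
    rw [← List.map_reverse] at h2
    exact absurd h2 not_startsAtSlot_above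
  | below e A hA hA' =>
    rw [← List.map_reverse] at h2
    exact hH _ _ _ hA' (seesFirst_below.1 hs) (startsAtSlot_below.1 h2) (j + 1) c' (by omega)
      (by omega) (avoids_below.1 hav)
  | down M e b Z hM hM' hZ s1 s2 =>
    exact hF _ _ _ hM' (seesFirst_above_append hM hs).1 s1 j c' (by omega) hj
      (avoids_above.1 hav.left)
  | up e b A M hM hA hM' s1 s2 =>
    rw [List.reverse_append, ← List.map_reverse] at h2
    exact absurd h2 (not_startsAtSlot_above_append (by simpa))
  | turn e b A M e' b' Z hM hA hM' hZ s1 s2 s3 s4 =>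
    obtain ⟨t1, t2⟩ := seesFirst_below_append s3.ne_nil_of_reverse hs
    exact (hb _ _ _ _ _ hA (Nat.succ_pos d) t1 s3).2 (j + 1) c' (by omega) (by omega)
      (avoids_below.1 hav.left)

theorem Between.comp (hF : F.Between) (hF' : F.EntrySees 0) (hb : H.Between) :
    (F.comp H).Between := by
  intro d₁ d₂ c₁ c₂ Q hQ hlt h1 h2
  cases split hQ with
  | above M hM =>
    rw [← List.map_reverse] at h2
    have := hF _ _ _ _ _ hM hlt (seesFirst_above.1 h1) (seesFirst_above.1 h2)
    rw [List.length_map]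
    exact ⟨this.1, fun j c h h' hav => this.2 j c h h' (avoids_above.1 hav)⟩
  | below e A hA hA' =>
    rw [← List.map_reverse] at h2
    have := hb _ _ _ _ _ hA' (Nat.succ_lt_succ hlt) (seesFirst_below.1 h1) (seesFirst_below.1 h2)
    rw [List.length_map]
    exact ⟨by omega, fun j c h h' hav =>
      this.2 (j + 1) c (by omega) (by omega) (avoids_below.1 hav)⟩
  | down M e b Z hM hM' hZ s1 s2 =>
    rw [List.reverse_append, ← List.map_reverse, ← List.map_reverse] at h2
    have t := (seesFirst_below_append (by simpa using s2.ne_nil) h2).2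
    exact absurd (by simpa using (avoids_above.1 t).reverse)
      (hF' _ _ _ hM' (seesFirst_above_append hM h1).1 s1 d₂ c₂ (Nat.zero_le _) hlt)
  | up e b A M hM hA hM' s1 s2 =>
    obtain ⟨t1, -⟩ := seesFirst_below_append s2.ne_nil_of_reverse h1
    rw [List.reverse_append, ← List.map_reverse, ← List.map_reverse] at h2
    have t := (seesFirst_above_append (by simpa) h2).2
    exact absurd (by simpa using (avoids_below.1 t).reverse)
      ((hb _ _ _ _ _ hA (Nat.succ_pos _) t1 s2).2 (d₂ + 1) c₂ (by omega) (by omega))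
  | turn e b A M e' b' Z hM hA hM' hZ s1 s2 s3 s4 =>
    obtain ⟨t1, -⟩ := seesFirst_below_append s3.ne_nil_of_reverse h1
    rw [List.reverse_append, List.reverse_append, ← List.map_reverse, ← List.map_reverse,
      ← List.map_reverse, List.append_assoc] at h2
    have t := (seesFirst_below_append (by simpa using s4.ne_nil) h2).2.right
    exact absurd (by simpa using (avoids_below.1 t).reverse)
      ((hb _ _ _ _ _ hA (Nat.succ_pos _) t1 s3).2 (d₂ + 1) c₂ (by omega) (by omega))

end comp

section merge

theorem merge_avoids {d c} {Q : List V} (h : B.merge.Avoids d c Q) : B.Avoids (d + 1) c Q :=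
  fun x hx hs => h x hx (Or.inl hs)

theorem merge_seesFirst {d c} {Q : List V} (h : B.merge.SeesFirst d c Q) :
    B.SeesFirst (d + 1) c Q ∨ d = 0 ∧ B.SeesFirst 0 c Q ∧ B.Avoids 1 c Q.tail := by
  obtain ⟨x, l, rfl, hx | ⟨rfl, hx⟩, hl⟩ := h
  · exact Or.inl ⟨x, l, rfl, hx, merge_avoids hl⟩
  · exact Or.inr ⟨rfl, ⟨x, l, rfl, hx, fun y hy hs => hl y hy (Or.inr ⟨rfl, hs⟩)⟩,
      merge_avoids hl⟩

theorem SlotSlotBound.merge {d n : ℕ} (h : B.SlotSlotBound (d + 1) n) :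
    B.merge.SlotSlotBound d n := fun c Q hQ h1 h2 h3 => h c Q hQ h1 h2 (merge_avoids h3)

theorem SlotBound.merge {d n : ℕ} (h : B.SlotBound (d + 1) n) :
    B.merge.SlotBound d n := fun c Q hQ h1 h3 => h c Q hQ h1 (merge_avoids h3)

theorem PathBound.merge {n : ℕ} (h : B.PathBound n) : B.merge.PathBound n := h

theorem EntryBound.merge {d n : ℕ} (h : B.EntryBound (d + 1) n) (h0 : d = 0 → B.EntryBound 0 n) :
    B.merge.EntryBound d n := by
  intro c Q hQ hs
  rcases merge_seesFirst hs with hs | ⟨hd, hs, -⟩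
  · exact h c Q hQ hs
  · exact h0 hd c Q hQ hs

theorem EntrySlotBound.merge {d n : ℕ} (h : B.EntrySlotBound (d + 1) n)
    (h0 : d = 0 → B.EntrySlotBound 0 n) : B.merge.EntrySlotBound d n := by
  intro c Q hQ hs
  rcases merge_seesFirst hs with hs | ⟨hd, hs, -⟩
  · exact h c Q hQ hs
  · exact h0 hd c Q hQ hs

theorem EntrySees.merge (h : B.EntrySees 1) : B.merge.EntrySees 0 := by
  intro d c Q hQ hs h2 j c' _ hj hav
  rcases merge_seesFirst hs with hs | ⟨hd, -, -⟩
  · exact h _ _ _ hQ hs h2 (j + 1) c' (by omega) (by omega) (merge_avoids hav)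
  · omega

theorem Between.merge (h : B.Between) : B.merge.Between := by
  intro d₁ d₂ c₁ c₂ Q hQ hlt h1 h2
  rcases merge_seesFirst h1 with h1 | ⟨hd, -, -⟩
  swap
  · omega
  rcases merge_seesFirst h2 with h2 | ⟨rfl, h2, h2'⟩
  · have := h _ _ _ _ _ hQ (Nat.succ_lt_succ hlt) h1 h2
    exact ⟨by omega, fun j c hj hj' hav =>
      this.2 (j + 1) c (by omega) (by omega) (merge_avoids hav)⟩
  · -- the last vertex is the only one that can see the second pair of the context
    have key := h _ _ _ _ _ hQ (Nat.succ_pos _) h1 h2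
    have h3 : B.SeesFirst 1 c₂ Q.reverse := by
      obtain ⟨x, l, e, -, -⟩ := h2
      rw [e, List.tail_cons] at h2'
      refine ⟨x, l, e, ?_, h2'⟩
      by_contra hx
      refine key.2 1 c₂ (by omega) (by omega) fun y hy => ?_
      have : y ∈ Q.reverse := List.mem_reverse.2 hy
      rw [e, List.mem_cons] at this
      rcases this with rfl | hy
      · exact hx
      · exact h2' y hy
    have := h _ _ _ _ _ hQ (by omega) h1 h3
    exact ⟨by omega, fun j c hj hj' hav =>
      this.2 (j + 1) c (by omega) (by omega) (merge_avoids hav)⟩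

end merge

end Gadget

/-- The path on `Fin m`. -/
def linePath (m : ℕ) : SimpleGraph (Fin m) where
  Adj x y := x.val + 1 = y.val ∨ y.val + 1 = x.val
  symm := ⟨fun _ _ h => h.symm⟩
  loopless := ⟨fun x h => by omega⟩

namespace linePath

variable {m : ℕ}

theorem map_val_eq_range' {x y : Fin m} {l : List (Fin m)}
    (hc : (x :: y :: l).IsChain (linePath m).Adj) (hn : (x :: y :: l).Nodup) (h : x.val + 1 = y.val) :
    (x :: y :: l).map Fin.val = List.range' x.val (l.length + 2) := by
  induction l generalizing x y with
  | nil => simp [List.range'_succ, h]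
  | cons z l ih =>
    rw [List.isChain_cons_cons] at hc
    have hyz : y.val + 1 = z.val := by
      rcases (List.isChain_cons_cons.1 hc.2).1 with h' | h'
      · exact h'
      · have : x = z := Fin.ext (by omega)
        simp [this] at hn
    have := ih hc.2 hn.of_cons hyz
    rw [List.map_cons, this, List.length_cons, List.range'_succ (n := l.length + 1 + 1), h]

theorem run_of_up {x y : Fin m} {Q l l' : List (Fin m)} {n : ℕ} (e : Q = x :: l)
    (e' : Q.reverse = y :: l') (h : Q.map Fin.val = List.range' x.val n) :
    x ≤ y ∧ Q.length + x.val = y.val + 1 ∧ ∀ z : Fin m, x.val ≤ z.val → z.val ≤ y.val → z ∈ Q := by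
  have hlen : Q.length = n := by simpa using congrArg List.length h
  have hpos : 0 < n := by rw [← hlen, e]; simp
  have hy : x.val + n = y.val + 1 := by
    have h1 := congrArg List.reverse h
    rw [← List.map_reverse, e', List.map_cons] at h1
    have h2 := congrArg List.head? h1
    simp only [List.head?_cons, List.head?_reverse] at h2
    obtain ⟨k, rfl⟩ : ∃ k, n = k + 1 := ⟨n - 1, by omega⟩
    rw [List.range'_concat] at h2
    simp at h2
    omega
  refine ⟨by rw [Fin.le_def]; omega, by omega, fun z h1 h2 => ?_⟩
  have : z.val ∈ Q.map Fin.val := by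
    rw [h, List.mem_range'_1]
    omega
  obtain ⟨w, hw, hwz⟩ := List.mem_map.1 this
  rwa [← Fin.ext hwz]

/-- A path in `linePath m` is monotone. -/
theorem run {x y : Fin m} {Q l l' : List (Fin m)} (hQ : InducedList (linePath m) Q)
    (e : Q = x :: l) (e' : Q.reverse = y :: l') :
    Q.length + min x.val y.val = max x.val y.val + 1 ∧
      ∀ z : Fin m, min x.val y.val ≤ z.val → z.val ≤ max x.val y.val → z ∈ Q := by
  rcases l with _ | ⟨w, l⟩
  · subst e
    simp only [List.reverse_cons, List.reverse_nil, List.nil_append, List.cons.injEq] at e'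
    obtain ⟨rfl, rfl⟩ := e'
    simp only [List.length_singleton, min_self, max_self, List.mem_singleton]
    exact ⟨by omega, fun z h1 h2 => Fin.ext (by omega)⟩
  have hc := hQ.2.1
  have hn := hQ.1
  rw [e] at hc hn
  rcases (List.isChain_cons_cons.1 hc).1 with h | h
  · have := map_val_eq_range' hc hn h
    rw [← e] at this
    obtain ⟨h1, h2, h3⟩ := run_of_up e e' this
    rw [Fin.le_def] at h1
    rw [min_eq_left h1, max_eq_right h1]
    exact ⟨h2, h3⟩
  · have hc' : ((x :: w :: l).map Fin.rev).IsChain (linePath m).Adj := by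
      rw [List.isChain_map]
      refine hc.imp fun a b hab => ?_
      have ha := Fin.val_rev a
      have hb := Fin.val_rev b
      have := a.isLt
      have := b.isLt
      rcases hab with hab | hab
      · right; omega
      · left; omega
    have hn' : ((x :: w :: l).map Fin.rev).Nodup := hn.map Fin.rev_injective
    have := map_val_eq_range' hc' hn' (by
      have ha := Fin.val_rev x
      have hb := Fin.val_rev w
      have := x.isLt
      have := w.isLt
      omega)
    have e2 : Q.map Fin.rev = x.rev :: w.rev :: l.map Fin.rev := by rw [e]; simp
    have e3 : (Q.map Fin.rev).reverse = y.rev :: l'.map Fin.rev := by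
      rw [← List.map_reverse, e']; simp
    obtain ⟨h1, h2, h3⟩ := run_of_up e2 e3 (by rw [e2]; exact this)
    have hx := Fin.val_rev x
    have hy := Fin.val_rev y
    have := x.isLt
    have := y.isLt
    rw [Fin.le_def] at h1
    rw [List.length_map] at h2
    refine ⟨by omega, fun z hz1 hz2 => ?_⟩
    have hz := Fin.val_rev z
    have := h3 z.rev (by omega) (by omega)
    obtain ⟨w, hw, hwz⟩ := List.mem_map.1 this
    rwa [← Fin.rev_injective hwz]

end linePath

theorem InducedList.length_le_of_fin {m : ℕ} {G : SimpleGraph (Fin m)} {Q : List (Fin m)}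
    (h : InducedList G Q) : Q.length ≤ m := by
  simpa using h.1.length_le_card

namespace Gadget

/-- The four vertices of the path with two slots. -/
def unit : Gadget (Fin 4) Bool where
  G := linePath 4
  slot e b := ⟨2 * e.toNat + b.toNat, by cases e <;> cases b <;> simp⟩
  sees x i b := i = 0 ∧ (x.val = 0 ∧ b = false ∨ x.val = 3 ∧ b = true)
  slot_adj e := Or.inl (by simp)

/-- Which vertices of the context the vertex `z` of a ladder is adjacent to. -/
def ladderSees (s z : ℕ) : ℕ → Bool → Prop
  | 0, b => z = 0 ∧ b = false ∨ z = 8 * s + 9 ∧ b = true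
  | i + 1, b => 2 * i + b.toNat < 2 * s + 2 ∧ (z = 2 * i + b.toNat ∨
      z + (2 * i + b.toNat) = 4 * s + 3 ∨ z = 4 * s + 6 + (2 * i + b.toNat) ∨
      z + (2 * i + b.toNat) = 8 * s + 9)

/-- A path that runs twice through the first `s + 1` pairs of the context on either side of its
central edge, which is a slot. -/
def ladder (s : ℕ) : Gadget (Fin (8 * s + 10)) Unit where
  G := linePath _
  slot _ b := ⟨4 * s + 4 + b.toNat, by cases b <;> simp <;> omega⟩
  sees x i b := ladderSees s x.val i b
  slot_adj e := Or.inl (by simp)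

theorem unit_pathBound : unit.PathBound 4 := fun _ hQ => hQ.length_le_of_fin

theorem unit_sees {x d c} (h : unit.sees x d c) : d = 0 := h.1

theorem unit_entrySees : unit.EntrySees 0 := by
  rintro d c Q hQ ⟨x, l, -, hx, -⟩ - j c' - hj
  have := unit_sees hx
  omega

theorem unit_between : unit.Between := by
  rintro d₁ d₂ c₁ c₂ Q hQ hlt ⟨x, l, -, hx, -⟩
  have := unit_sees hx
  omega

theorem ladder_pathBound (s : ℕ) : (ladder s).PathBound (8 * s + 10) :=
  fun _ hQ => hQ.length_le_of_fin

theorem ladder_slotSlotBound (s d : ℕ) : (ladder s).SlotSlotBound d 2 := by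
  rintro c Q hQ ⟨_, b, l, e⟩ ⟨_, b', l', e'⟩ -
  have := (linePath.run hQ e e').1
  simp only [ladder] at this
  have h1 := Bool.toNat_le b
  have h2 := Bool.toNat_le b'
  omega

theorem toNat_lt_two (b : Bool) : b.toNat < 2 := by cases b <;> simp

theorem ladder_entrySlotBound (s d : ℕ) : (ladder s).EntrySlotBound (d + 1) (2 * d + 4) := by
  rintro c Q hQ ⟨x, l, e, ⟨hx, hx'⟩, hl⟩ ⟨_, b', l', e'⟩
  obtain ⟨h1, h2⟩ := linePath.run hQ e e'
  have hb' := toNat_lt_two b'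
  have hc := toNat_lt_two c
  have hlt := x.isLt
  have key : ∀ z : ℕ, min x.val (4 * s + 4 + b'.toNat) ≤ z → z ≤ max x.val (4 * s + 4 + b'.toNat) →
      z ≠ x.val → ¬ ladderSees s z (d + 1) c := by
    intro z hz1 hz2 hz3 hz4
    have hz : z < 8 * s + 10 := by omega
    have := h2 ⟨z, hz⟩ hz1 hz2
    rw [e, List.mem_cons] at this
    rcases this with h | h
    · exact hz3 (congrArg Fin.val h)
    · exact hl _ h hz4
  simp only [ladder] at h1
  generalize ht : 2 * d + c.toNat = t at *
  simp only [ladderSees, ht] at key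
  rcases hx' with h | h | h | h
  · exact (key (4 * s + 3 - t) (by omega) (by omega) (by omega) (by omega)).elim
  · omega
  · omega
  · exact (key (4 * s + 6 + t) (by omega) (by omega) (by omega) (by omega)).elim

theorem ladder_entrySees (s : ℕ) : (ladder s).EntrySees 1 := by
  rintro d c Q hQ ⟨x, l, e, hx, hl⟩ ⟨_, b', l', e'⟩ j c' hj hjd hav
  obtain ⟨i, rfl⟩ : ∃ i, d = i + 1 := ⟨d - 1, by omega⟩
  obtain ⟨k, rfl⟩ : ∃ k, j = k + 1 := ⟨j - 1, by omega⟩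
  obtain ⟨hx, hx'⟩ := hx
  obtain ⟨h1, h2⟩ := linePath.run hQ e e'
  have hb' := toNat_lt_two b'
  have hc := toNat_lt_two c
  have hc' := toNat_lt_two c'
  have hlt := x.isLt
  have key : ∀ z : ℕ, min x.val (4 * s + 4 + b'.toNat) ≤ z → z ≤ max x.val (4 * s + 4 + b'.toNat) →
      ¬ ladderSees s z (k + 1) c' := fun z hz1 hz2 => hav _ (h2 ⟨z, by omega⟩ hz1 hz2)
  simp only [ladder] at h1
  have hlt' : 2 * k + c'.toNat < 2 * i + c.toNat := by omega
  simp only [ladderSees] at key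
  generalize 2 * k + c'.toNat = u at *
  generalize ht : 2 * i + c.toNat = t at *
  rcases hx' with h | h | h | h
  · exact key (4 * s + 3 - u) (by omega) (by omega) (by omega)
  · exact key (4 * s + 3 - u) (by omega) (by omega) (by omega)
  · exact key (4 * s + 6 + u) (by omega) (by omega) (by omega)
  · exact key (4 * s + 6 + u) (by omega) (by omega) (by omega)

theorem ladder_sealed {s d : ℕ} (h : d ≤ s) : (ladder s).Sealed d := by
  rintro b c Q hQ ⟨x, l, e, hx, hl⟩ ⟨_, b', l', e'⟩ hav
  obtain ⟨h1, h2⟩ := linePath.run hQ e e'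
  have hb' := toNat_lt_two b'
  have hc := toNat_lt_two c
  have key : ∀ z : ℕ, min x.val (4 * s + 4 + b'.toNat) ≤ z → z ≤ max x.val (4 * s + 4 + b'.toNat) →
      ¬ ladderSees s z (d + 1) c := fun z hz1 hz2 => hav _ (h2 ⟨z, by omega⟩ hz1 hz2)
  simp only [ladderSees] at key
  generalize ht : 2 * d + c.toNat = t at *
  rcases hx with ⟨hx, -⟩ | ⟨hx, -⟩
  · exact key t (by omega) (by omega) (by omega)
  · exact key (8 * s + 9 - t) (by omega) (by omega) (by omega)

theorem ladder_between (s : ℕ) : (ladder s).Between := by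
  rintro d₁ d₂ c₁ c₂ Q hQ hlt ⟨x, l, e, hx, hl⟩ ⟨y, l', e', hy, hl'⟩
  obtain ⟨i, rfl⟩ : ∃ i, d₁ = i + 1 := ⟨d₁ - 1, by omega⟩
  obtain ⟨hx, hx'⟩ := hx
  obtain ⟨h1, h2⟩ := linePath.run hQ e e'
  have hc₁ := toNat_lt_two c₁
  have hc₂ := toNat_lt_two c₂
  have hxlt := x.isLt
  have hylt := y.isLt
  have keyx : ∀ z : ℕ, min x.val y.val ≤ z → z ≤ max x.val y.val → z ≠ x.val →
      ¬ ladderSees s z (i + 1) c₁ := by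
    intro z hz1 hz2 hz3 hz4
    have := h2 ⟨z, by omega⟩ hz1 hz2
    rw [e, List.mem_cons] at this
    rcases this with h | h
    · exact hz3 (congrArg Fin.val h)
    · exact hl _ h hz4
  have keyy : ∀ z : ℕ, min x.val y.val ≤ z → z ≤ max x.val y.val → z ≠ y.val →
      ¬ ladderSees s z d₂ c₂ := by
    intro z hz1 hz2 hz3 hz4
    have := List.mem_reverse.2 (h2 ⟨z, by omega⟩ hz1 hz2)
    rw [e', List.mem_cons] at this
    rcases this with h | h
    · exact hz3 (congrArg Fin.val h)
    · exact hl' _ h hz4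
  have fin : ∀ j c, (∃ z, min x.val y.val ≤ z ∧ z ≤ max x.val y.val ∧ ladderSees s z j c) →
      ¬ (ladder s).Avoids j c Q := by
    rintro j c ⟨z, hz1, hz2, hz3⟩ hav
    exact hav _ (h2 ⟨z, by omega⟩ hz1 hz2) hz3
  have hx4 : x.val = 2 * i + c₁.toNat ∨ x.val + (2 * i + c₁.toNat) = 4 * s + 3 ∨
      x.val = 4 * s + 6 + (2 * i + c₁.toNat) ∨ x.val + (2 * i + c₁.toNat) = 8 * s + 9 := hx'
  clear h2 hl hl' hx'
  simp only [ladderSees] at keyx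
  rcases d₂ with _ | k
  · have hx5 : x.val = 2 * i + c₁.toNat ∧ y.val = 0 ∨
        x.val + (2 * i + c₁.toNat) = 8 * s + 9 ∧ y.val = 8 * s + 9 := by
      generalize 2 * i + c₁.toNat = t at *
      rcases hy with ⟨hy, -⟩ | ⟨hy, -⟩
      · have := keyx t
        omega
      · have := keyx (8 * s + 9 - t)
        omega
    refine ⟨by omega, fun j c hj hj' => fin j c ?_⟩
    obtain ⟨k, rfl⟩ : ∃ k, j = k + 1 := ⟨j - 1, by omega⟩
    have hc := toNat_lt_two c
    simp only [ladderSees]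
    rcases hx5 with hx5 | hx5
    · exact ⟨2 * k + c.toNat, by omega, by omega, by omega, by omega⟩
    · exact ⟨8 * s + 9 - (2 * k + c.toNat), by omega, by omega, by omega, by omega⟩
  · obtain ⟨hy, hy'⟩ := hy
    have hy4 : y.val = 2 * k + c₂.toNat ∨ y.val + (2 * k + c₂.toNat) = 4 * s + 3 ∨
      y.val = 4 * s + 6 + (2 * k + c₂.toNat) ∨ y.val + (2 * k + c₂.toNat) = 8 * s + 9 := hy'
    clear hy'
    simp only [ladderSees] at keyy
    have hx5 : x.val = 2 * i + c₁.toNat ∧ y.val = 2 * k + c₂.toNat ∨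
        x.val + (2 * i + c₁.toNat) = 4 * s + 3 ∧ y.val + (2 * k + c₂.toNat) = 4 * s + 3 ∨
        x.val = 4 * s + 6 + (2 * i + c₁.toNat) ∧ y.val = 4 * s + 6 + (2 * k + c₂.toNat) ∨
        x.val + (2 * i + c₁.toNat) = 8 * s + 9 ∧ y.val + (2 * k + c₂.toNat) = 8 * s + 9 := by
      have hlt' : 2 * k + c₂.toNat < 2 * i + c₁.toNat := by omega
      generalize 2 * i + c₁.toNat = t at *
      generalize 2 * k + c₂.toNat = u at *
      have k1 := keyx t
      have k2 := keyx (4 * s + 3 - t)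
      have k3 := keyx (4 * s + 6 + t)
      have k4 := keyx (8 * s + 9 - t)
      have k5 := keyy (4 * s + 3 - u)
      have k6 := keyy (4 * s + 6 + u)
      clear keyx keyy fin h1 e e'
      rcases hx4 with h | h | h | h <;> rcases hy4 with h' | h' | h' | h' <;> omega
    refine ⟨by omega, fun j c hj hj' => fin j c ?_⟩
    obtain ⟨q, rfl⟩ : ∃ q, j = q + 1 := ⟨j - 1, by omega⟩
    have hc := toNat_lt_two c
    simp only [ladderSees]
    rcases hx5 with hx5 | hx5 | hx5 | hx5
    · exact ⟨2 * q + c.toNat, by omega, by omega, by omega, by omega⟩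
    · exact ⟨4 * s + 3 - (2 * q + c.toNat), by omega, by omega, by omega, by omega⟩
    · exact ⟨4 * s + 6 + (2 * q + c.toNat), by omega, by omega, by omega, by omega⟩
    · exact ⟨8 * s + 9 - (2 * q + c.toNat), by omega, by omega, by omega, by omega⟩

variable {V E W I : Type} {X F B : Gadget V E} {H : Gadget W I}

theorem encard_pair_le {α : Type*} (a b : α) : ({a, b} : Set α).encard ≤ 2 :=
  (Set.encard_insert_le _ _).trans (by rw [Set.encard_singleton]; norm_num)

/-- Every finite nonempty set of vertices contains one with at most two neighbours in the set and
the context together. -/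
def Sparse (X : Gadget V E) : Prop :=
  ∀ S : Set V, S.Finite → S.Nonempty → ∃ v ∈ S,
    {u ∈ S | X.G.Adj v u}.encard + {p : ℕ × Bool | X.sees v p.1 p.2}.encard ≤ 2

theorem Sparse.degenerate (h : X.Sparse) : Degenerate 2 X.G := by
  intro S hS hne
  obtain ⟨v, hv, h⟩ := h S hS hne
  refine ⟨v, hv, ENat.toNat_le_of_le_natCast ?_⟩
  exact le_self_add.trans h

theorem Sparse.comp (hF : F.Sparse) (hH : H.Sparse) : (F.comp H).Sparse := by
  intro S hS hne
  by_cases hr : ∃ e y, (Sum.inr (e, y) : V ⊕ E × W) ∈ S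
  · obtain ⟨e, y₀, hy₀⟩ := hr
    have hinj : Function.Injective (below F H e) := fun a b h => by simpa using h
    obtain ⟨y, hy, hle⟩ := hH (below F H e ⁻¹' S) (hS.preimage hinj.injOn) ⟨y₀, hy₀⟩
    refine ⟨Sum.inr (e, y), hy, le_trans ?_ hle⟩
    set C := {b : Bool | H.sees y 0 b}
    have h1 : {u ∈ S | (F.comp H).G.Adj (Sum.inr (e, y)) u} ⊆
        below F H e '' {u ∈ below F H e ⁻¹' S | H.G.Adj y u} ∪
          (fun b => Sum.inl (F.slot e b)) '' C := by
      rintro (u | ⟨e', u⟩) ⟨hu, h⟩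
      · obtain ⟨b, rfl, hb⟩ := h
        exact Or.inr ⟨b, hb, rfl⟩
      · obtain ⟨rfl, h⟩ := h
        exact Or.inl ⟨u, ⟨hu, h⟩, rfl⟩
    have h2 : {p : ℕ × Bool | H.sees y p.1 p.2} = (fun b => (0, b)) '' C ∪
        (fun p : ℕ × Bool => (p.1 + 1, p.2)) ''
          {p : ℕ × Bool | (F.comp H).sees (Sum.inr (e, y)) p.1 p.2} := by
      ext ⟨i, b⟩
      cases i with
      | zero => simp [C]
      | succ i => simp [C, Gadget.comp]
    have h3 : Disjoint ((fun b => (0, b)) '' C) ((fun p : ℕ × Bool => (p.1 + 1, p.2)) ''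
          {p : ℕ × Bool | (F.comp H).sees (Sum.inr (e, y)) p.1 p.2}) := by
      rw [Set.disjoint_left]
      rintro _ ⟨b, -, rfl⟩ ⟨p, -, h⟩
      simp at h
    have i1 : Function.Injective fun b : Bool => ((0, b) : ℕ × Bool) := fun a b h => by
      simpa using h
    have i2 : Function.Injective fun p : ℕ × Bool => (p.1 + 1, p.2) := fun a b h => by
      simpa [Prod.ext_iff] using h
    rw [h2, Set.encard_union_eq h3, i1.encard_image, i2.encard_image, ← add_assoc]
    gcongr
    exact (Set.encard_le_encard h1).trans ((Set.encard_union_le _ _).trans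
      (add_le_add (Set.encard_image_le _ _) (Set.encard_image_le _ _)))
  · obtain ⟨v₀, hv₀⟩ := hne
    obtain ⟨x₀, rfl⟩ : ∃ x, v₀ = Sum.inl x := by
      rcases v₀ with x | ⟨e, y⟩
      · exact ⟨x, rfl⟩
      · exact absurd ⟨e, y, hv₀⟩ hr
    obtain ⟨x, hx, hle⟩ := hF (above F H ⁻¹' S) (hS.preimage Sum.inl_injective.injOn) ⟨x₀, hv₀⟩
    refine ⟨Sum.inl x, hx, le_trans (add_le_add ?_ le_rfl) hle⟩
    rw [← (Sum.inl_injective (α := V) (β := E × W)).encard_image]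
    refine Set.encard_le_encard ?_
    rintro (u | ⟨e', u⟩) ⟨hu, h⟩
    · exact ⟨u, ⟨hu, h⟩, rfl⟩
    · exact absurd ⟨_, _, hu⟩ hr

theorem Sparse.merge (h : B.Sparse) : B.merge.Sparse := by
  intro S hS hne
  obtain ⟨v, hv, hle⟩ := h S hS hne
  refine ⟨v, hv, le_trans (add_le_add le_rfl ?_) hle⟩
  refine le_trans (Set.encard_le_encard ?_)
    (Set.encard_image_le (fun p : ℕ × Bool => (p.1 - 1, p.2)) _)
  rintro ⟨i, b⟩ (h | ⟨rfl, h⟩)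
  · exact ⟨(i + 1, b), h, by simp⟩
  · exact ⟨(0, b), h, by simp⟩

theorem unit_sparse : unit.Sparse := by
  intro S hS hne
  obtain ⟨v, hv, hmax⟩ := Set.exists_max_image S id hS hne
  refine ⟨v, hv, le_trans (add_le_add (b := 1) (d := 1) ?_ ?_) (by norm_num)⟩
  · rw [Set.encard_le_one_iff]
    rintro a b ⟨ha, ha'⟩ ⟨hb, hb'⟩
    have h1 := Fin.le_def.1 (hmax a ha)
    have h2 := Fin.le_def.1 (hmax b hb)
    simp only [id, unit, linePath] at *
    exact Fin.ext (by omega)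
  · rw [Set.encard_le_one_iff]
    rintro ⟨i, b⟩ ⟨i', b'⟩ ⟨rfl, h⟩ ⟨rfl, h'⟩
    simp only at h h'
    rcases h with ⟨h, rfl⟩ | ⟨h, rfl⟩ <;> rcases h' with ⟨h', rfl⟩ | ⟨h', rfl⟩
    · rfl
    · omega
    · omega
    · rfl

theorem ladder_sparse (s : ℕ) : (ladder s).Sparse := by
  intro S hS hne
  obtain ⟨v, hv, hmax⟩ := Set.exists_max_image S
    (fun x : Fin (8 * s + 10) => min x.val (8 * s + 9 - x.val)) hS hne
  have hvlt := v.isLt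
  have hn : ∀ u ∈ {u ∈ S | (ladder s).G.Adj v u}, (v.val + 1 = u.val ∨ u.val + 1 = v.val) ∧
      min u.val (8 * s + 9 - u.val) ≤ min v.val (8 * s + 9 - v.val) ∧ u.val < 8 * s + 10 :=
    fun u hu => ⟨hu.2, hmax u hu.1, u.isLt⟩
  refine ⟨v, hv, ?_⟩
  change _ + {p : ℕ × Bool | ladderSees s v.val p.1 p.2}.encard ≤ 2
  by_cases h0 : v.val = 0 ∨ v.val = 8 * s + 9
  · have e : {u ∈ S | (ladder s).G.Adj v u} = ∅ := by
      rw [Set.eq_empty_iff_forall_notMem]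
      intro u hu
      have := hn u hu
      omega
    rw [e, Set.encard_empty, zero_add]
    refine (Set.encard_le_encard (t := {(0, decide (v.val ≠ 0)), (1, false)}) ?_).trans
      (encard_pair_le _ _)
    rintro ⟨i, b⟩ h
    rcases i with _ | i
    · left
      rcases h with ⟨h, h'⟩ | ⟨h, h'⟩
      · simp_all
      · simp only at h h'
        simp [h', h]
    · right
      obtain ⟨h1, h2⟩ := h
      simp only at h1 h2
      cases b
      · have : i = 0 := by simp only [Bool.toNat_false] at h1 h2; omega
        simp [this]
      · simp only [Bool.toNat_true] at h1 h2
        omega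
  by_cases h1 : v.val = 4 * s + 4 ∨ v.val = 4 * s + 5
  · have e : {p : ℕ × Bool | ladderSees s v.val p.1 p.2} = ∅ := by
      rw [Set.eq_empty_iff_forall_notMem]
      rintro ⟨i, b⟩ h
      rcases i with _ | i
      · rcases h with ⟨h, -⟩ | ⟨h, -⟩ <;> omega
      · obtain ⟨h2, h3⟩ := h
        simp only at h2 h3
        omega
    rw [e, Set.encard_empty, add_zero]
    refine (Set.encard_le_encard (t := {⟨v.val - 1, by omega⟩, ⟨v.val + 1, by omega⟩}) ?_).trans
      (encard_pair_le _ _)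
    intro u hu
    have := (hn u hu).1
    rcases this with h | h
    · exact Or.inr (Fin.ext h.symm)
    · exact Or.inl (Fin.ext (show u.val = v.val - 1 by omega))
  · refine le_trans (add_le_add (b := 1) (d := 1) ?_ ?_) (by norm_num)
    · rw [Set.encard_le_one_iff]
      intro a b ha hb
      have := hn a ha
      have := hn b hb
      exact Fin.ext (by omega)
    · rw [Set.encard_le_one_iff]
      rintro ⟨i, b⟩ ⟨i', b'⟩ h h'
      rcases i with _ | i
      · rcases h with ⟨h, -⟩ | ⟨h, -⟩ <;> omega
      rcases i' with _ | i'
      · rcases h' with ⟨h, -⟩ | ⟨h, -⟩ <;> omega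
      obtain ⟨h2, h3⟩ := h
      obtain ⟨h2', h3'⟩ := h'
      simp only at h2 h3 h2' h3'
      have e : 2 * i + b.toNat = 2 * i' + b'.toNat := by omega
      have hb := toNat_lt_two b
      have hb' := toNat_lt_two b'
      have e1 : i = i' := by omega
      have e2 : b = b' := by
        subst e1
        cases b <;> cases b' <;> simp_all
      rw [e1, e2]

/-- Consecutive vertices of a tour: after the first vertex of a slot comes its second vertex. -/
def Step (X : Gadget V E) (x y : V) : Prop :=
  X.G.Adj x y ∧ ∀ e, x = X.slot e false → y = X.slot e true

/-- The list is a path from the first to the second vertex of the own slot of the gadget which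
passes through all slots. -/
structure IsTour (X : Gadget V E) (p : List V) : Prop where
  nodup : p.Nodup
  chain : p.IsChain X.Step
  head : ∃ a l, p = a :: l ∧ X.sees a 0 false
  last : ∃ a l, p = l ++ [a] ∧ X.sees a 0 true ∧ ∀ e, a ≠ X.slot e false
  mem : ∀ e, X.slot e false ∈ p
  inj : Function.Injective fun e => X.slot e false

open Classical in
/-- Insert a list below each slot. -/
noncomputable def expandAt (F : Gadget V E) (q : List W) (x : V) : List (V ⊕ E × W) :=
  Sum.inl x :: if h : ∃ e, x = F.slot e false then q.map fun y => Sum.inr (h.choose, y) else []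

theorem expandAt_slot (hF : Function.Injective fun e => F.slot e false) (q : List W) (e : E) :
    F.expandAt q (F.slot e false) =
      Sum.inl (F.slot e false) :: q.map fun y => Sum.inr (e, y) := by
  have h : ∃ e', F.slot e false = F.slot e' false := ⟨e, rfl⟩
  rw [expandAt, dif_pos h, ← hF h.choose_spec]

theorem expandAt_of_ne (q : List W) {x : V} (h : ∀ e, x ≠ F.slot e false) :
    F.expandAt q x = [Sum.inl x] := by
  rw [expandAt, dif_neg (by simpa using h)]

theorem isChain_expandAt {q : List W} (hi : Function.Injective fun e => F.slot e false)
    (hq : H.IsTour q) (x : V) : (F.expandAt q x).IsChain (F.comp H).Step := by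
  by_cases hx : ∃ e, x = F.slot e false
  · obtain ⟨e, rfl⟩ := hx
    rw [expandAt_slot hi]
    have h1 : (q.map fun y => Sum.inr (e, y)).IsChain (F.comp H).Step := by
      rw [List.isChain_map]
      refine hq.chain.imp fun a b hab => ⟨⟨rfl, hab.1⟩, fun e' he' => ?_⟩
      simp only [Gadget.comp, Sum.inr.injEq, Prod.mk.injEq] at he' ⊢
      exact ⟨he'.1, hab.2 _ he'.2⟩
    obtain ⟨a, l, rfl, ha⟩ := hq.head
    rw [List.map_cons] at h1 ⊢
    rw [List.isChain_cons_cons]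
    exact ⟨⟨⟨false, rfl, ha⟩, fun e' he' => by simp [Gadget.comp] at he'⟩, h1⟩
  · rw [expandAt_of_ne q (by simpa using hx)]
    exact List.isChain_singleton _

theorem step_of_mem_getLast {q : List W} (hi : Function.Injective fun e => F.slot e false)
    (hq : H.IsTour q) {x y : V} (hxy : F.Step x y) :
    ∀ z ∈ (F.expandAt q x).getLast?, (F.comp H).Step z (Sum.inl y) := by
  intro z hz
  by_cases hx : ∃ e, x = F.slot e false
  · obtain ⟨e, rfl⟩ := hx
    rw [expandAt_slot hi] at hz
    obtain ⟨a, l, rfl, ha, ha'⟩ := hq.last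
    rw [List.map_append, List.map_singleton, ← List.cons_append] at hz
    simp only [List.getLast?_append, List.getLast?_singleton, Option.some_or, Option.mem_def,
      Option.some.injEq] at hz
    subst hz
    refine ⟨⟨true, hxy.2 e rfl, ha⟩, fun e' he' => ?_⟩
    simp only [Gadget.comp, Sum.inr.injEq, Prod.mk.injEq] at he'
    exact absurd he'.2 (ha' _)
  · rw [expandAt_of_ne q (by simpa using hx)] at hz
    simp only [List.getLast?_singleton, Option.mem_def, Option.some.injEq] at hz
    subst hz
    exact ⟨hxy.1, fun e' he' => by simp [Gadget.comp] at he'⟩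

theorem isChain_flatMap_expandAt {q : List W} (hi : Function.Injective fun e => F.slot e false)
    (hq : H.IsTour q) {p : List V} (hp : p.IsChain F.Step) :
    (p.flatMap (F.expandAt q)).IsChain (F.comp H).Step := by
  induction p with
  | nil => simp
  | cons x p ih =>
    rw [List.flatMap_cons, List.isChain_append]
    refine ⟨isChain_expandAt hi hq x, ih hp.of_cons, fun z hz w hw => ?_⟩
    cases p with
    | nil => simp at hw
    | cons y p =>
      rw [List.isChain_cons_cons] at hp
      simp only [expandAt, List.flatMap_cons, List.cons_append, List.head?_cons, Option.mem_def,
        Option.some.injEq] at hw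
      subst hw
      exact step_of_mem_getLast hi hq hp.1 z hz

theorem IsTour.comp {p : List V} {q : List W} (hp : F.IsTour p) (hq : H.IsTour q) :
    (F.comp H).IsTour (p.flatMap (F.expandAt q)) where
  nodup := by
    rw [List.nodup_flatMap]
    constructor
    · intro x _
      by_cases hx : ∃ e, x = F.slot e false
      · obtain ⟨e, rfl⟩ := hx
        rw [expandAt_slot hp.inj, List.nodup_cons]
        exact ⟨by simp, hq.nodup.map fun a b h => by simpa using h⟩
      · rw [expandAt_of_ne q (by simpa using hx)]
        exact List.nodup_singleton _
    · refine hp.nodup.imp fun {x y} hxy => ?_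
      have key : ∀ x z, z ∈ F.expandAt q x → z = Sum.inl x ∨
          ∃ e w, x = F.slot e false ∧ z = Sum.inr (e, w) := by
        intro x z hz
        by_cases hx : ∃ e, x = F.slot e false
        · obtain ⟨e, rfl⟩ := hx
          rw [expandAt_slot hp.inj, List.mem_cons, List.mem_map] at hz
          rcases hz with hz | ⟨w, -, rfl⟩
          · exact Or.inl hz
          · exact Or.inr ⟨e, w, rfl, rfl⟩
        · rw [expandAt_of_ne q (by simpa using hx), List.mem_singleton] at hz
          exact Or.inl hz
      intro z hz hz'
      rcases key x z hz with rfl | ⟨e, w, rfl, rfl⟩ <;>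
        rcases key y _ hz' with h | ⟨e', w', rfl, h⟩
      · exact hxy (by simpa using h)
      · simp at h
      · simp at h
      · simp only [Sum.inr.injEq, Prod.mk.injEq] at h
        exact hxy (by rw [h.1])
  chain := isChain_flatMap_expandAt hp.inj hq hp.chain
  head := by
    obtain ⟨a, l, rfl, ha⟩ := hp.head
    exact ⟨Sum.inl a, _, by rw [List.flatMap_cons, expandAt, List.cons_append], ha⟩
  last := by
    obtain ⟨a, l, rfl, ha, ha'⟩ := hp.last
    refine ⟨Sum.inl a, l.flatMap (F.expandAt q), ?_, ha, fun e h => by simp [Gadget.comp] at h⟩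
    rw [List.flatMap_append, List.flatMap_singleton, expandAt_of_ne q ha']
  mem := by
    rintro ⟨e, e'⟩
    refine List.mem_flatMap.2 ⟨F.slot e false, hp.mem e, ?_⟩
    rw [expandAt_slot hp.inj]
    exact List.mem_cons_of_mem _ (List.mem_map.2 ⟨H.slot e' false, hq.mem e', rfl⟩)
  inj := by
    rintro ⟨e, e'⟩ ⟨f, f'⟩ h
    simp only [Gadget.comp, Sum.inr.injEq, Prod.mk.injEq] at h
    exact Prod.ext h.1 (hq.inj h.2)

theorem IsTour.merge {p : List V} (hp : B.IsTour p) : B.merge.IsTour p where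
  nodup := hp.nodup
  chain := hp.chain
  head := by
    obtain ⟨a, l, e, h⟩ := hp.head
    exact ⟨a, l, e, Or.inr ⟨rfl, h⟩⟩
  last := by
    obtain ⟨a, l, e, h, h'⟩ := hp.last
    exact ⟨a, l, e, Or.inr ⟨rfl, h⟩, h'⟩
  mem := hp.mem
  inj := hp.inj

theorem isChain_finRange (m : ℕ) : (List.finRange m).IsChain fun x y => x.val + 1 = y.val := by
  rw [List.isChain_iff_getElem]
  intro i hi
  simp

theorem finRange_eq_append (m : ℕ) : ∃ l, List.finRange (m + 1) = l ++ [Fin.last m] :=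
  ⟨_, List.finRange_succ_last⟩

theorem unit_isTour : unit.IsTour (List.finRange 4) where
  nodup := List.nodup_finRange 4
  chain := by
    refine (isChain_finRange 4).imp fun x y h => ⟨Or.inl h, fun e he => Fin.ext ?_⟩
    have := congrArg Fin.val he
    simp only [unit, Bool.toNat_false, Bool.toNat_true] at this ⊢
    omega
  head := ⟨0, _, List.finRange_succ, rfl, Or.inl ⟨rfl, rfl⟩⟩
  last := by
    obtain ⟨l, hl⟩ := finRange_eq_append 3
    refine ⟨_, l, hl, ⟨rfl, Or.inr ⟨rfl, rfl⟩⟩, fun e he => ?_⟩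
    have := congrArg Fin.val he
    simp only [unit, Bool.toNat_false, Fin.val_last] at this
    omega
  mem e := List.mem_finRange _
  inj e e' h := by
    have := congrArg Fin.val h
    cases e <;> cases e' <;> simp_all [unit]

theorem ladder_isTour (s : ℕ) : (ladder s).IsTour (List.finRange (8 * s + 10)) where
  nodup := List.nodup_finRange _
  chain := by
    refine (isChain_finRange _).imp fun x y h => ⟨Or.inl h, fun e he => Fin.ext ?_⟩
    have := congrArg Fin.val he
    simp only [ladder, Bool.toNat_false, Bool.toNat_true] at this ⊢
    omega
  head := ⟨0, _, List.finRange_succ, Or.inl ⟨rfl, rfl⟩⟩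
  last := by
    obtain ⟨l, hl⟩ := finRange_eq_append (8 * s + 9)
    refine ⟨_, l, hl, Or.inr ⟨rfl, rfl⟩, fun e he => ?_⟩
    have := congrArg Fin.val he
    simp only [ladder, Bool.toNat_false, Fin.val_last] at this
    omega
  mem e := List.mem_finRange _
  inj e e' h := rfl

theorem IsTour.card_le {p : List V} [Finite E] (hp : X.IsTour p) : Nat.card E ≤ p.length := by
  classical
  have := Fintype.ofFinite E
  rw [Nat.card_eq_fintype_card, ← Finset.card_univ,
    ← Finset.card_image_of_injective _ hp.inj]
  refine (Finset.card_le_card (t := p.toFinset) fun x hx => ?_).trans p.toFinset_card_le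
  obtain ⟨e, -, rfl⟩ := Finset.mem_image.1 hx
  exact List.mem_toFinset.2 (hp.mem e)

theorem IsTour.hasPathOn {p : List V} (hp : X.IsTour p) {n : ℕ} (hn : n ≤ p.length) :
    HasPathOn X.G n := by
  refine ⟨fun i => p[i.val]'(by omega), fun i j h => ?_, fun i h => ?_⟩
  · exact Fin.ext ((List.Nodup.getElem_inj_iff hp.nodup).1 h)
  · exact ((List.isChain_iff_getElem.1 hp.chain) i (by omega)).1

end Gadget

theorem inducedList_ofFn {V : Type} {G : SimpleGraph V} {m : ℕ} {p : Fin m → V}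
    (hi : Function.Injective p)
    (h : ∀ i j : Fin m, G.Adj (p i) (p j) ↔ (i.val + 1 = j.val ∨ j.val + 1 = i.val)) :
    InducedList G (List.ofFn p) := by
  refine ⟨List.nodup_ofFn.2 hi, ?_, fun l₁ a l₂ b l₃ e hab => ?_⟩
  · rw [List.isChain_iff_getElem]
    intro i hi
    simp only [List.getElem_ofFn]
    exact (h _ _).2 (Or.inl rfl)
  · have hlen := congrArg List.length e
    simp only [List.length_ofFn, List.length_append, List.length_cons] at hlen
    have ha : p ⟨l₁.length, by omega⟩ = a := by
      have : (List.ofFn p)[l₁.length]'(by rw [List.length_ofFn]; omega) = a := by simp [e]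
      simpa using this
    have hb : p ⟨l₁.length + 1 + l₂.length, by omega⟩ = b := by
      have : (List.ofFn p)[l₁.length + 1 + l₂.length]'(by rw [List.length_ofFn]; omega) = b := by
        simp only [e]
        rw [List.getElem_append_right (by omega), List.getElem_cons]
        rw [dif_neg (by omega), List.getElem_append_right (by omega)]
        simp [show l₁.length + 1 + l₂.length - l₁.length - 1 - l₂.length = 0 by omega]
      simpa using this
    rw [← ha, ← hb, h] at hab
    simp only at hab
    exact List.eq_nil_of_length_eq_zero (by omega)

namespace Gadget

variable {V E W I : Type} {X F B : Gadget V E} {H : Gadget W I}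

/-- One less than the number of pairs of the context that the ladder at height `v` passes. -/
def height (L v : ℕ) : ℕ := 4 * Nat.gcd v (2 ^ L)

/-- The recursive bound for the paths between slots. -/
def slotBd (L : ℕ) : ℕ → ℕ → ℕ
  | 0, d => if d ≤ height L 0 then 2 else 4 + 2 * (8 * height L 0 + 10)
  | v + 1, d => if d ≤ height L (v + 1) then 2 else
      slotBd L v (d + 1) + 8 + 2 * (8 * height L (v + 1) + 10)

/-- The slope of the bound for the paths entering from the context. -/
def slope (L : ℕ) : ℕ := 128 * L + 72

/-- The constant term of the bound for the paths entering from the context. -/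
def offset (L : ℕ) : ℕ := 34 * 2 ^ L + 18

/-- The bound for all induced paths. -/
def pathBd (L : ℕ) : ℕ :=
  64 * (L * 2 ^ L) + 156 * 2 ^ L + 32 + 2 * (slope L * 2 ^ L) + 4 * offset L + 12

theorem height_le (L v : ℕ) : height L v ≤ 4 * 2 ^ L := by
  have := Nat.gcd_le_right v (show 0 < 2 ^ L by positivity)
  unfold height
  omega

theorem height_zero (L : ℕ) : height L 0 = 4 * 2 ^ L := by simp [height]

theorem length_ladder_le (L v : ℕ) : 8 * height L v + 10 ≤ offset L := by
  have := height_le L v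
  have : 1 ≤ 2 ^ L := Nat.one_le_two_pow
  unfold offset
  omega

theorem le_height {L l u : ℕ} (hl : l ≤ L) (h : 2 ^ l ∣ u) : 4 * 2 ^ l ≤ height L u :=
  Nat.mul_le_mul_left 4 (Nat.le_of_dvd (Nat.gcd_pos_of_pos_right _ (by positivity))
    (Nat.dvd_gcd h (pow_dvd_pow 2 hl)))

theorem two_le_slotBd (L v d : ℕ) : 2 ≤ slotBd L v d := by
  induction v generalizing d with
  | zero => rw [slotBd]; split <;> omega
  | succ v ih =>
    have := ih (d + 1)
    rw [slotBd]; split <;> omega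

theorem slotBd_le (L u r d : ℕ) : slotBd L (u + r) d ≤
    slotBd L u (d + r) + 28 * r + 64 * ∑ i ∈ Finset.range r, Nat.gcd (u + i + 1) (2 ^ L) := by
  induction r generalizing d with
  | zero => simp
  | succ r ih =>
    have h1 := ih (d + 1)
    have h2 := two_le_slotBd L u (d + (r + 1))
    have e : d + 1 + r = d + (r + 1) := by ring
    rw [e] at h1
    rw [Finset.sum_range_succ, ← add_assoc u r 1, slotBd, height]
    split <;> omega

theorem gcd_le_of_dvd {L l u : ℕ} (h : 2 ^ (l + 1) ∣ u) : Nat.gcd (u + 2 ^ l) (2 ^ L) ≤ 2 ^ l := by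
  obtain ⟨q, rfl⟩ := h
  have e : 2 ^ (l + 1) * q + 2 ^ l = (2 * q + 1) * 2 ^ l := by ring
  have hc : Nat.Coprime (2 * q + 1) (2 ^ L) := by
    apply Nat.Coprime.pow_right
    rw [Nat.coprime_two_right]
    exact ⟨q, rfl⟩
  rw [e, Nat.Coprime.gcd_mul_left_cancel _ hc]
  exact Nat.gcd_le_left _ (by positivity)

theorem sum_gcd_le (L l u : ℕ) (h : 2 ^ l ∣ u) :
    ∑ i ∈ Finset.range (2 ^ l - 1), Nat.gcd (u + i + 1) (2 ^ L) ≤ l * 2 ^ l := by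
  induction l generalizing u with
  | zero => simp
  | succ l ih =>
    have hpos : 1 ≤ 2 ^ l := Nat.one_le_two_pow
    have hd : 2 ^ l ∣ u := (pow_dvd_pow 2 (Nat.le_succ l)).trans h
    have e : 2 ^ (l + 1) - 1 = (2 ^ l - 1) + 1 + (2 ^ l - 1) := by rw [pow_succ]; omega
    have h1 := ih u hd
    have h2 := ih (u + 2 ^ l) (Dvd.dvd.add hd dvd_rfl)
    have h3 := gcd_le_of_dvd (L := L) h
    rw [e, Finset.sum_range_add, Finset.sum_range_succ]
    have e1 : ∀ i, u + (2 ^ l - 1 + 1 + i) + 1 = u + 2 ^ l + i + 1 := fun i => by omega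
    have e2 : u + (2 ^ l - 1) + 1 = u + 2 ^ l := by omega
    simp only [e1, e2]
    have e3 : (l + 1) * 2 ^ (l + 1) = l * 2 ^ l + l * 2 ^ l + 2 * 2 ^ l := by ring
    omega

theorem slotBd_le_slope {L v d : ℕ} (h1 : 1 ≤ d) (hd : d ≤ 2 ^ L) :
    slotBd L v d + 2 * d + 12 ≤ slope L * d := by
  obtain ⟨l, hl, hl1, hl2⟩ : ∃ l, l ≤ L ∧ d ≤ 2 ^ l ∧ 2 ^ l ≤ 2 * d := by
    refine ⟨Nat.clog 2 d, Nat.clog_le_of_le_pow hd, Nat.le_pow_clog (by norm_num) d, ?_⟩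
    rcases Nat.eq_or_lt_of_le h1 with rfl | h1
    · simp
    · have := Nat.pow_pred_clog_lt_self (b := 2) (by norm_num) h1
      have hp : 0 < Nat.clog 2 d := Nat.clog_pos (by norm_num) h1
      obtain ⟨k, hk⟩ : ∃ k, Nat.clog 2 d = k + 1 := ⟨Nat.clog 2 d - 1, by omega⟩
      rw [hk] at this ⊢
      simp only [Nat.pred_succ] at this
      rw [pow_succ]
      omega
  have hu : 2 ^ l ∣ 2 ^ l * (v / 2 ^ l) := Dvd.intro _ rfl
  have hr : v % 2 ^ l < 2 ^ l := Nat.mod_lt _ (by positivity)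
  have key := slotBd_le L (2 ^ l * (v / 2 ^ l)) (v % 2 ^ l) d
  rw [Nat.div_add_mod] at key
  have h2 : slotBd L (2 ^ l * (v / 2 ^ l)) (d + v % 2 ^ l) = 2 := by
    have := le_height hl hu
    generalize 2 ^ l * (v / 2 ^ l) = u at *
    cases u with
    | zero => rw [slotBd, if_pos (by omega)]
    | succ u => rw [slotBd, if_pos (by omega)]
  have h3 : ∑ i ∈ Finset.range (v % 2 ^ l), Nat.gcd (2 ^ l * (v / 2 ^ l) + i + 1) (2 ^ L) ≤
      l * 2 ^ l :=
    (Finset.sum_le_sum_of_subset (Finset.range_subset_range.2 (by omega))).trans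
      (sum_gcd_le L l _ hu)
  have h4 : l * 2 ^ l ≤ L * (2 * d) := Nat.mul_le_mul hl hl2
  have e : slope L * d = 64 * (L * (2 * d)) + 72 * d := by rw [slope]; ring
  omega

theorem slotBd_le_of_le {L v : ℕ} (hv : v ≤ 2 ^ L) (d : ℕ) :
    slotBd L v d ≤ 64 * (L * 2 ^ L) + 156 * 2 ^ L + 32 := by
  have key := slotBd_le L 0 v d
  have hpos : 1 ≤ 2 ^ L := Nat.one_le_two_pow
  have h0 : slotBd L 0 (d + v) ≤ 4 + 2 * (8 * (4 * 2 ^ L) + 10) := by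
    rw [slotBd, height_zero]
    split <;> omega
  have h1 : ∑ i ∈ Finset.range v, Nat.gcd (0 + i + 1) (2 ^ L) ≤ L * 2 ^ L + 2 ^ L := by
    refine (Finset.sum_le_sum_of_subset
      (Finset.range_subset_range.2 (show v ≤ (2 ^ L - 1) + 1 by omega))).trans ?_
    rw [Finset.sum_range_succ]
    exact add_le_add (sum_gcd_le L L 0 (dvd_zero _)) (Nat.gcd_le_right _ (by positivity))
  rw [zero_add] at key
  omega

/-- The vertices see only the first `n` pairs of the context. -/
def SeesBelow (X : Gadget V E) (n : ℕ) : Prop := ∀ x d c, X.sees x d c → d < n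

theorem SeesBelow.not_sees {n : ℕ} (h : X.SeesBelow n) (x : V) (c : Bool) : ¬ X.sees x n c :=
  fun hs => lt_irrefl _ (h x n c hs)

theorem SeesBelow.comp {n : ℕ} (hF : F.SeesBelow n) (hH : H.SeesBelow n) :
    (F.comp H).SeesBelow n := by
  rintro (x | ⟨e, y⟩) d c h
  · exact hF x d c h
  · exact Nat.lt_of_succ_lt (hH y (d + 1) c h)

theorem SeesBelow.merge {n : ℕ} (hB : B.SeesBelow n) : B.merge.SeesBelow n := by
  rintro x d c (h | ⟨rfl, h⟩)
  · exact Nat.lt_of_succ_lt (hB x (d + 1) c h)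
  · exact hB x 0 c h

theorem ladder_seesBelow (s : ℕ) : (ladder s).SeesBelow (s + 2) := by
  rintro x (_ | d) c h
  · omega
  · have := h.1
    omega

/-- The properties of the gadgets that are preserved by all constructions. -/
structure Basic (L : ℕ) (X : Gadget V E) : Prop where
  between : X.Between
  entrySees : X.EntrySees 0
  sparse : X.Sparse
  tour : ∃ p, X.IsTour p
  seesBelow : X.SeesBelow (4 * 2 ^ L + 2)

theorem Basic.merge {L : ℕ} (h : B.Basic L) : B.merge.Basic L where
  between := h.between.merge
  entrySees := EntrySees.merge fun d c Q hQ h1 h2 j c' _ => h.entrySees d c Q hQ h1 h2 j c' j.zero_le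
  sparse := h.sparse.merge
  tour := h.tour.imp fun _ hp => hp.merge
  seesBelow := h.seesBelow.merge

theorem Basic.comp {L : ℕ} (hF : F.Basic L) (hH : H.Basic L) : (F.comp H).Basic L where
  between := hF.between.comp hF.entrySees hH.between
  entrySees := hF.entrySees.comp
    (fun d c Q hQ h1 h2 j c' _ => hH.entrySees d c Q hQ h1 h2 j c' j.zero_le) hH.between
  sparse := hF.sparse.comp hH.sparse
  tour := by
    obtain ⟨p, hp⟩ := hF.tour
    obtain ⟨q, hq⟩ := hH.tour
    exact ⟨_, hp.comp hq⟩
  seesBelow := hF.seesBelow.comp hH.seesBelow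

theorem Basic.comp_ladder {L s : ℕ} (hF : F.Basic L) (hs : s ≤ 4 * 2 ^ L) :
    (F.comp (ladder s)).Basic L where
  between := hF.between.comp hF.entrySees (ladder_between s)
  entrySees := hF.entrySees.comp (ladder_entrySees s) (ladder_between s)
  sparse := hF.sparse.comp (ladder_sparse s)
  tour := by
    obtain ⟨p, hp⟩ := hF.tour
    exact ⟨_, hp.comp (ladder_isTour s)⟩
  seesBelow := hF.seesBelow.comp fun x d c h => by
    have := ladder_seesBelow s x d c h
    omega

theorem unit_basic (L : ℕ) : unit.Basic L where
  between := unit_between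
  entrySees := unit_entrySees
  sparse := unit_sparse
  tour := ⟨_, unit_isTour⟩
  seesBelow _ _ _ h := by
    have := unit_sees h
    omega

section PathBound

variable {n : ℕ}

theorem PathBound.slotSlotBound (h : X.PathBound n) (d : ℕ) : X.SlotSlotBound d n :=
  fun _ Q hQ _ _ _ => h Q hQ

theorem PathBound.slotBound (h : X.PathBound n) (d : ℕ) : X.SlotBound d n :=
  fun _ Q hQ _ _ => h Q hQ

theorem PathBound.entryBound (h : X.PathBound n) (d : ℕ) : X.EntryBound d n :=
  fun _ Q hQ _ => h Q hQ

theorem PathBound.entrySlotBound (h : X.PathBound n) (d : ℕ) : X.EntrySlotBound d n :=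
  fun _ Q hQ _ _ => h Q hQ

end PathBound

theorem SlotSlotBound.mono {d m n : ℕ} (h : X.SlotSlotBound d m) (hmn : m ≤ n) :
    X.SlotSlotBound d n := fun c Q hQ h1 h2 h3 => (h c Q hQ h1 h2 h3).trans hmn

theorem EntryBound.mono {d m n : ℕ} (h : X.EntryBound d m) (hmn : m ≤ n) :
    X.EntryBound d n := fun c Q hQ h1 => (h c Q hQ h1).trans hmn

theorem EntrySlotBound.mono {d m n : ℕ} (h : X.EntrySlotBound d m) (hmn : m ≤ n) :
    X.EntrySlotBound d n := fun c Q hQ h1 h2 => (h c Q hQ h1 h2).trans hmn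

/-- The bounds on induced paths in the gadget at height `v`. -/
structure Bounded (L v : ℕ) (X : Gadget V E) : Prop extends X.Basic L where
  entrySlot_zero : X.EntrySlotBound 0 4
  slotSlot : ∀ d, X.SlotSlotBound d (slotBd L v d)
  entrySlot : ∀ d, X.EntrySlotBound d (slotBd L v d + 2 * d + 8)
  slot : ∀ d, X.SlotBound d (slotBd L v d + slope L * v + offset L)
  entry : ∀ d, v + d ≤ 2 ^ L → X.EntryBound d (slope L * (v + d) + offset L)
  path : X.PathBound (pathBd L)

theorem bounded_zero (L : ℕ) : (unit.comp (ladder (height L 0))).Bounded L 0 := by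
  have hΛ := length_ladder_le L 0
  have hs := height_zero L
  have hl := ladder_pathBound (height L 0)
  have hu := unit_pathBound
  have hb := ladder_between (height L 0)
  have hlow : ∀ d, (d ≤ height L 0 ∧ slotBd L 0 d = 2) ∨
      slotBd L 0 d = 4 + 2 * (8 * height L 0 + 10) := by
    intro d
    rw [slotBd]
    split <;> simp_all
  constructor
  · exact (unit_basic L).comp_ladder (height_le L 0)
  · exact (ladder_entrySlotBound _ 0).comp (hu.slotSlotBound 0) (hu.entrySlotBound 0)
      (hl.entrySlotBound 0) hb le_rfl (Or.inl (ladder_sealed (Nat.zero_le _)))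
  · intro d
    refine (ladder_slotSlotBound _ _).comp (hu.slotSlotBound d) (hl.entrySlotBound 0)
      (two_le_slotBd L 0 d) ?_
    rcases hlow d with ⟨h, -⟩ | h
    · exact Or.inl (ladder_sealed h)
    · right; omega
  · intro d
    refine (ladder_entrySlotBound _ d).comp (hu.slotSlotBound d) (hu.entrySlotBound d)
      (hl.entrySlotBound 0) hb (by omega) ?_
    rcases hlow d with ⟨h, -⟩ | h
    · exact Or.inl (ladder_sealed h)
    · right; omega
  · intro d
    refine (hl.slotBound _).comp (hu.slotSlotBound d) (hu.slotBound d)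
      (hl.entrySlotBound 0) (hl.entryBound 0) (by omega) ?_
    rcases hlow d with ⟨h, -⟩ | h
    · exact Or.inl (ladder_sealed h)
    · right; omega
  · intro d hd
    have : 2 * 2 ^ L + 8 + (8 * height L 0 + 10) ≤ offset L := by
      rw [hs, offset]
      omega
    refine (hl.entryBound _).comp (hu.slotSlotBound d) (hu.slotBound d) (hu.entrySlotBound d)
      (hl.entryBound 0) (hu.entryBound d) hb ?_ ?_ ?_ ?_ ?_ <;> omega
  · have : 4 * offset L + 12 ≤ pathBd L := by unfold pathBd; omega
    exact hl.comp (unit_basic L).seesBelow.not_sees hu (hu.slotSlotBound _) (hu.slotBound _)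
      (hl.entryBound 0) (by omega) (by omega) (by omega) (by omega)

namespace Bounded

variable {L v : ℕ}

theorem slotSlot_core (h : B.Bounded L v) (d : ℕ) :
    (B.merge.comp B).SlotSlotBound d (slotBd L v (d + 1) + 8) :=
  (h.slotSlot (d + 1)).comp (h.slotSlot (d + 1)).merge h.entrySlot_zero (by omega)
    (Or.inr (by omega))

theorem entrySlot_merge (h : B.Bounded L v) (d : ℕ) :
    B.merge.EntrySlotBound d (slotBd L v (d + 1) + 2 * d + 10) :=
  EntrySlotBound.merge ((h.entrySlot (d + 1)).mono (by omega))
    fun _ => h.entrySlot_zero.mono (by omega)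

theorem entrySlot_core (h : B.Bounded L v) (d : ℕ) :
    (B.merge.comp B).EntrySlotBound d (slotBd L v (d + 1) + 2 * d + 14) :=
  (h.entrySlot (d + 1)).comp (h.slotSlot (d + 1)).merge (h.entrySlot_merge d) h.entrySlot_zero
    h.between (by omega) (Or.inr (by omega))

theorem slot_core (h : B.Bounded L v) (hv : v ≤ 2 ^ L) (d : ℕ) :
    (B.merge.comp B).SlotBound d (slotBd L v (d + 1) + slope L * v + offset L + 4) := by
  have h0 := h.entry 0 hv
  rw [Nat.add_zero] at h0
  exact (h.slot (d + 1)).comp (h.slotSlot (d + 1)).merge (h.slot (d + 1)).merge h.entrySlot_zero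
    h0 (by omega) (Or.inr (by omega))

theorem entry_core (h : B.Bounded L v) {d : ℕ} (hd : v + 1 + d ≤ 2 ^ L) :
    (B.merge.comp B).EntryBound d (slope L * (v + 1 + d) + offset L) := by
  have hs := slotBd_le_slope (L := L) (v := v) (d := d + 1) (by omega) (by omega)
  have e : slope L * (v + 1 + d) = slope L * v + slope L * (d + 1) := by ring
  have e' : slope L * (v + (d + 1)) = slope L * v + slope L * (d + 1) := by ring
  have h1 := h.entry (d + 1) (by omega)
  have h0 := h.entry 0 (by omega)
  rw [Nat.add_zero] at h0
  refine h1.comp (h.slotSlot (d + 1)).merge (h.slot (d + 1)).merge (h.entrySlot_merge d) h0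
    (EntryBound.merge h1 fun _ => h0.mono ?_) h.between ?_ ?_ ?_ ?_ ?_ <;> omega

theorem path_core (h : B.Bounded L v) (hv : v ≤ 2 ^ L) :
    (B.merge.comp B).PathBound (pathBd L) := by
  have h0 := h.entry 0 hv
  rw [Nat.add_zero] at h0
  have hle := slotBd_le_of_le hv (4 * 2 ^ L + 2 + 1)
  have hK : slope L * v ≤ slope L * 2 ^ L := Nat.mul_le_mul_left _ hv
  refine h.path.comp h.toBasic.merge.seesBelow.not_sees h.path.merge (h.slotSlot _).merge
    (h.slot _).merge h0 le_rfl le_rfl ?_ ?_ <;> unfold pathBd <;> omega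

theorem succ (h : B.Bounded L v) (hv : v ≤ 2 ^ L) :
    ((B.merge.comp B).comp (ladder (height L (v + 1)))).Bounded L (v + 1) := by
  have hΛ := length_ladder_le L (v + 1)
  have hl := ladder_pathBound (height L (v + 1))
  have hb := ladder_between (height L (v + 1))
  have hC := h.toBasic.merge.comp h.toBasic
  have hlow : ∀ d, (d ≤ height L (v + 1) ∧ slotBd L (v + 1) d = 2) ∨
      slotBd L (v + 1) d = slotBd L v (d + 1) + 8 + 2 * (8 * height L (v + 1) + 10) := by
    intro d
    rw [slotBd]
    split <;> simp_all
  have e : slope L * (v + 1) = slope L * v + slope L := by ring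
  constructor
  · exact hC.comp_ladder (height_le L (v + 1))
  · exact (ladder_entrySlotBound _ 0).comp (h.slotSlot_core 0) (h.entrySlot_core 0)
      (hl.entrySlotBound 0) hb le_rfl (Or.inl (ladder_sealed (Nat.zero_le _)))
  · intro d
    refine (ladder_slotSlotBound _ _).comp (h.slotSlot_core d) (hl.entrySlotBound 0)
      (two_le_slotBd L _ d) ?_
    rcases hlow d with ⟨h, -⟩ | h
    · exact Or.inl (ladder_sealed h)
    · right; omega
  · intro d
    refine (ladder_entrySlotBound _ d).comp (h.slotSlot_core d) (h.entrySlot_core d)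
      (hl.entrySlotBound 0) hb (by omega) ?_
    rcases hlow d with ⟨h, -⟩ | h
    · exact Or.inl (ladder_sealed h)
    · right; omega
  · intro d
    refine (hl.slotBound _).comp (h.slotSlot_core d) (h.slot_core hv d)
      (hl.entrySlotBound 0) (hl.entryBound 0) (by omega) ?_
    rcases hlow d with ⟨h, -⟩ | h
    · exact Or.inl (ladder_sealed h)
    · right; omega
  · intro d hd
    have hs := slotBd_le_slope (L := L) (v := v) (d := d + 1) (by omega) (by omega)
    have e' : slope L * (v + 1 + d) = slope L * v + slope L * (d + 1) := by ring
    refine (hl.entryBound _).comp (h.slotSlot_core d) (h.slot_core hv d) (h.entrySlot_core d)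
      (hl.entryBound 0) (h.entry_core hd) hb ?_ ?_ ?_ ?_ ?_ <;> omega
  · have hle := slotBd_le_of_le hv (4 * 2 ^ L + 2 + 1)
    have hK : slope L * v ≤ slope L * 2 ^ L := Nat.mul_le_mul_left _ hv
    refine hl.comp hC.seesBelow.not_sees (h.path_core hv) (h.slotSlot_core _)
      (h.slot_core hv _) (hl.entryBound 0) ?_ le_rfl ?_ ?_ <;> unfold pathBd <;> omega

end Bounded

theorem exists_bounded (L v : ℕ) (hv : v ≤ 2 ^ L) :
    ∃ (V E : Type) (_ : Finite V) (_ : Finite E) (X : Gadget V E),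
      X.Bounded L v ∧ Nat.card E = 2 ^ 2 ^ v := by
  induction v with
  | zero => exact ⟨_, _, inferInstance, inferInstance, _, bounded_zero L, by simp⟩
  | succ v ih =>
    obtain ⟨V, E, _, _, B, hB, hE⟩ := ih (by omega)
    refine ⟨_, _, inferInstance, inferInstance, _, hB.succ (by omega), ?_⟩
    rw [Nat.card_prod, Nat.card_prod, hE, Nat.card_unique, mul_one, ← pow_add, pow_succ 2 v, mul_two]

end Gadget

theorem exists_two_degenerate_with_long_path_short_induced_paths :
    ∃ c : ℝ, 0 < c ∧ ∀ N : ℕ, ∃ n : ℕ, N ≤ n ∧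
      ∃ (V : Type) (_ : Fintype V) (G : SimpleGraph V),
        Degenerate 2 G ∧ HasPathOn G n ∧
        ∀ m : ℕ, HasInducedPathOn G m →
          (m : ℝ) ≤ c * Real.logb 2 (Real.logb 2 n) *
            Real.logb 2 (Real.logb 2 (Real.logb 2 n)) := by
  refine ⟨1000, by norm_num, fun N => ?_⟩
  obtain ⟨V, E, _, _, X, hX, hE⟩ := Gadget.exists_bounded (N + 1) (2 ^ (N + 1)) le_rfl
  refine ⟨2 ^ 2 ^ 2 ^ (N + 1), ?_, V, Fintype.ofFinite V, X.G, hX.sparse.degenerate, ?_, ?_⟩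
  · calc N ≤ N + 1 := Nat.le_succ N
      _ ≤ 2 ^ (N + 1) := Nat.lt_two_pow_self.le
      _ ≤ 2 ^ 2 ^ (N + 1) := Nat.lt_two_pow_self.le
      _ ≤ 2 ^ 2 ^ 2 ^ (N + 1) := Nat.lt_two_pow_self.le
  · obtain ⟨p, hp⟩ := hX.tour
    exact hp.hasPathOn (hE ▸ hp.card_le)
  · rintro m ⟨p, hi, hp⟩
    have h1 := hX.path _ (inducedList_ofFn hi hp)
    rw [List.length_ofFn] at h1
    have hlog : ∀ k : ℕ, Real.logb 2 ((2 : ℝ) ^ k) = k := fun k => by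
      rw [Real.logb_pow, Real.logb_self_eq_one (by norm_num), mul_one]
    have e1 : Real.logb 2 ((2 ^ 2 ^ 2 ^ (N + 1) : ℕ) : ℝ) = 2 ^ 2 ^ (N + 1) := by
      rw [Nat.cast_pow, Nat.cast_two, hlog]
      push_cast
      rfl
    have e2 : Real.logb 2 ((2 : ℝ) ^ 2 ^ (N + 1)) = 2 ^ (N + 1) := by
      rw [hlog]
      push_cast
      rfl
    rw [e1, e2, hlog]
    have h2 : Gadget.pathBd (N + 1) ≤ 1000 * 2 ^ (N + 1) * (N + 1) := by
      have h3 : 2 ^ 1 ≤ 2 ^ (N + 1) := Nat.pow_le_pow_right (by norm_num) (by omega)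
      have h4 : 0 ≤ N * 2 ^ (N + 1) := Nat.zero_le _
      simp only [Gadget.pathBd, Gadget.slope, Gadget.offset]
      generalize 2 ^ (N + 1) = P at *
      nlinarith
    exact_mod_cast h1.trans h2
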